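/- The following are equivalent: (i) every endomorphism of A₁ is an automorphism of A₁ (the Dixmier conjecture); (ii) for every endomorphism f of A₁ there exist g and h, each an automorphism or an anti-automorphism of A₁, such that (h ∘ f ∘ g⁻¹) ∘ α = α ∘ (h ∘ f ∘ g⁻¹) (the g,h conjecture). -/

import Mathlib

noncomputable section

/-- `f : A → A` is a `K`-algebra endomorphism (as a bare function). -/
def IsAlgEndo (K : Type) [CommSemiring K] {A : Type} [Semiring A] [Algebra K A]
    (f : A → A) : Prop :=
  (∀ a b : A, f (a + b) = f a + f b) ∧
  (∀ (c : K) (a : A), f (c • a) = c • f a) ∧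
  (∀ a b : A, f (a * b) = f a * f b) ∧ f 1 = 1

/-- `f : A → A` is a `K`-algebra automorphism: a bijective endomorphism. -/
def IsAlgAuto (K : Type) [CommSemiring K] {A : Type} [Semiring A] [Algebra K A]
    (f : A → A) : Prop :=
  IsAlgEndo K f ∧ Function.Bijective f

/-- `f : A → A` is a `K`-linear anti-endomorphism. -/
def IsAntiEndo (K : Type) [CommSemiring K] {A : Type} [Semiring A] [Algebra K A]
    (f : A → A) : Prop :=
  (∀ a b : A, f (a + b) = f a + f b) ∧
  (∀ (c : K) (a : A), f (c • a) = c • f a) ∧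
  (∀ a b : A, f (a * b) = f b * f a) ∧ f 1 = 1

/-- `f : A → A` is an anti-automorphism: a bijective anti-endomorphism. -/
def IsAntiAuto (K : Type) [CommSemiring K] {A : Type} [Semiring A] [Algebra K A]
    (f : A → A) : Prop :=
  IsAntiEndo K f ∧ Function.Bijective f

/-- An involution on a `K`-algebra: an anti-automorphism of order at most two. -/
def IsInvolutionOn (K : Type) [CommSemiring K] {A : Type} [Semiring A] [Algebra K A]
    (γ : A → A) : Prop :=
  IsAntiAuto K γ ∧ γ ∘ γ = id

/-- The defining relation of the first Weyl algebra: `Y*X = X*Y + 1`. -/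
inductive WeylRel (K : Type) [CommSemiring K] :
    FreeAlgebra K (Fin 2) → FreeAlgebra K (Fin 2) → Prop
  | rel : WeylRel K (FreeAlgebra.ι K 1 * FreeAlgebra.ι K 0)
      (FreeAlgebra.ι K 0 * FreeAlgebra.ι K 1 + 1)

/-- The first Weyl algebra `A₁(K) = K⟨X,Y⟩/(YX - XY - 1)`. -/
abbrev Weyl (K : Type) [CommSemiring K] : Type := RingQuot (WeylRel K)

/-- The generator `X` of the Weyl algebra. -/
def Wx (K : Type) [CommSemiring K] : Weyl K :=
  RingQuot.mkAlgHom K (WeylRel K) (FreeAlgebra.ι K 0)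

/-- The generator `Y` of the Weyl algebra. -/
def Wy (K : Type) [CommSemiring K] : Weyl K :=
  RingQuot.mkAlgHom K (WeylRel K) (FreeAlgebra.ι K 1)

/-- `α` is the exchange involution: the involution with `α X = Y` and `α Y = X`. -/
def IsExchange (K : Type) [CommSemiring K] (α : Weyl K → Weyl K) : Prop :=
  IsInvolutionOn K α ∧ α (Wx K) = Wy K ∧ α (Wy K) = Wx K

/-- `γ` is conjugate to `α` by an automorphism or an anti-automorphism:
`γ = g⁻¹ ∘ α ∘ g`. -/
def ConjToAlpha (K : Type) [CommSemiring K] (α γ : Weyl K → Weyl K) : Prop :=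
  ∃ g : Weyl K → Weyl K, (IsAlgAuto K g ∨ IsAntiAuto K g) ∧
    γ = Function.invFun g ∘ α ∘ g

namespace WP
open Finset

section ring
variable {W : Type*} [Ring W]

theorem rel_pow {a b : W} (h : b * a = a * b + 1) (k : ℕ) :
    b * a ^ k = a ^ k * b + (k : W) * a ^ (k - 1) := by
  induction k with
  | zero => simp
  | succ k ih =>
    rw [pow_succ, ← mul_assoc, ih, add_mul, mul_assoc, h]
    rcases k with _ | k
    · simp
    · simp only [Nat.add_sub_cancel, mul_assoc, ← pow_succ]
      push_cast
      noncomm_ring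

theorem rel_pow' {a b : W} (h : b * a = a * b + 1) (k : ℕ) :
    b ^ k * a = a * b ^ k + (k : W) * b ^ (k - 1) := by
  induction k with
  | zero => simp
  | succ k ih =>
    rw [pow_succ', mul_assoc, ih, mul_add, ← mul_assoc, h]
    rcases k with _ | k
    · simp
    · simp only [Nat.add_sub_cancel]
      rw [(Nat.cast_commute (k+1) b).symm.left_comm, ← pow_succ']
      push_cast
      noncomm_ring

theorem rel_pow_pow {a b : W} (h : b * a = a * b + 1) (j k : ℕ) :
    b ^ j * a ^ k = ∑ r ∈ range (j + 1),
      ((j.choose r * k.descFactorial r : ℕ) : W) * (a ^ (k - r) * b ^ (j - r)) := by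
  induction j with
  | zero => simp
  | succ j ih =>
    rw [pow_succ', mul_assoc, ih, mul_sum]
    have e : ∀ r ∈ range (j+1), b * (((j.choose r * k.descFactorial r : ℕ) : W) * (a ^ (k - r) * b ^ (j - r)))
       = ((j.choose r * k.descFactorial r : ℕ) : W) * (a ^ (k - r) * b ^ (j + 1 - r))
        + ((j.choose r * k.descFactorial (r+1) : ℕ) : W) * (a ^ (k - (r+1)) * b ^ (j - r)) := by
      intro r hr
      have hr' : r ≤ j := by simpa [Nat.lt_succ_iff] using hr
      rw [(Nat.cast_commute _ b).symm.left_comm, ← mul_assoc b, rel_pow h, add_mul, mul_add]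
      congr 1
      · rw [mul_assoc, ← pow_succ']; congr 3; omega
      · rw [Nat.descFactorial_succ, mul_assoc, ← mul_assoc, ← Nat.cast_mul, Nat.sub_sub]
        congr 2; ring
    rw [sum_congr rfl e, sum_add_distrib, sum_range_succ' _ (j+1)]
    have e2 : ∀ r ∈ range (j+1), (((j+1).choose (r+1) * k.descFactorial (r+1) : ℕ) : W) * (a ^ (k - (r+1)) * b ^ (j + 1 - (r+1)))
       = ((j.choose (r+1) * k.descFactorial (r+1) : ℕ) : W) * (a ^ (k - (r+1)) * b ^ (j + 1 - (r+1)))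
        + ((j.choose r * k.descFactorial (r+1) : ℕ) : W) * (a ^ (k - (r+1)) * b ^ (j - r)) := by
      intro r hr
      rw [Nat.add_sub_add_right, Nat.choose_succ_succ, ← add_mul, ← Nat.cast_add]
      congr 2; ring
    rw [sum_congr rfl e2, sum_add_distrib]
    have := sum_range_succ' (fun r => ((j.choose r * k.descFactorial r : ℕ) : W) * (a ^ (k - r) * b ^ (j + 1 - r))) (j+1)
    rw [sum_range_succ] at this
    simp only [Nat.choose_succ_self, zero_mul, Nat.cast_zero, add_zero] at this
    rw [this]
    simp only [Nat.choose_zero_right]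
    abel

theorem pp_of_sq {a b : W} (h : b * a = a * b + 1) (p : ℕ) (hp : p.Prime) (h2 : (p : W) ^ 2 = 0) :
    b ^ p * a ^ p = a ^ p * b ^ p + (p.factorial : W) := by
  rw [rel_pow_pow h, sum_range_succ]
  obtain ⟨q, rfl⟩ : ∃ q, p = q + 1 := ⟨p - 1, by have := hp.pos; omega⟩
  rw [sum_range_succ']
  rw [sum_eq_zero]
  · simp only [Nat.choose_self, one_mul, Nat.descFactorial_self, Nat.sub_self, pow_zero, mul_one,
      Nat.choose_zero_right, Nat.descFactorial_zero, Nat.cast_one, Nat.sub_zero, zero_add]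
  · intro r hr
    have hr' : r < q := by simpa using hr
    have h1 : (q+1) ∣ (q+1).choose (r+1) := hp.dvd_choose_self (by omega) (by omega)
    have : (q+1)^2 ∣ (q+1).choose (r+1) * (q+1).descFactorial (r+1) := by
      rw [pow_two]
      refine mul_dvd_mul h1 ?_
      rw [Nat.descFactorial_eq_factorial_mul_choose]
      exact h1.mul_left _
    obtain ⟨c, hc⟩ := this
    rw [hc]
    push_cast at h2 ⊢
    rw [h2]; simp

theorem comm_pow_of_sq {S T c : W} (hc : ∀ z, c * z = z * c) (hc2 : c * c = 0)
    (h : T * S = S * T + c) (j k : ℕ) :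
    T ^ j * S ^ k = S ^ k * T ^ j + c * ((j * k : ℕ) : W) * (S ^ (k-1) * T ^ (j-1)) := by
  have h1 : ∀ k : ℕ, T * S ^ k = S ^ k * T + c * (k : W) * S ^ (k-1) := by
    intro k
    induction k with
    | zero => simp
    | succ k ih =>
      rw [pow_succ, ← mul_assoc, ih, add_mul, mul_assoc, h]
      rcases k with _ | k
      · simp
      · simp only [Nat.add_sub_cancel, mul_assoc, ← pow_succ, mul_add, ← hc]
        push_cast
        noncomm_ring
  induction j with
  | zero => simp
  | succ j ih =>
    rw [pow_succ', mul_assoc, ih, mul_add, ← mul_assoc, h1, add_mul, Nat.add_sub_cancel]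
    rcases j with _ | j
    · simp
    · have : ∀ n : W, Commute n T → Commute n c → T * (c * n * (S ^ (k-1) * T ^ (j+1-1)))
          = c * n * (S ^ (k-1) * T ^ (j+1)) := by
        intro n hn hnc
        have e : T * S ^ (k-1) * T ^ j = S ^ (k-1) * T ^ (j+1) + c * (((k-1 : ℕ) : W) * S ^ (k-1-1) * T ^ j) := by
          rw [h1, add_mul, pow_succ']
          simp only [mul_assoc]
        calc T * (c * n * (S ^ (k-1) * T ^ (j+1-1))) = c * (n * (T * S ^ (k-1) * T ^ j)) := by
              rw [Nat.add_sub_cancel, mul_assoc c, ← mul_assoc T, ← hc, mul_assoc c, ← mul_assoc T n, ← hn.eq]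
              simp only [mul_assoc]
          _ = c * n * (S ^ (k-1) * T ^ (j+1)) := by
              rw [e, mul_add, mul_add, ← mul_assoc n c, hnc.eq, mul_assoc c n, ← mul_assoc c c, hc2]
              simp only [mul_assoc, zero_mul, add_zero]
      rw [this _ (Nat.cast_commute _ _) (Nat.cast_commute _ _), mul_assoc, ← pow_succ', add_assoc]
      congr 1
      rw [mul_assoc (c * (k : W)), ← add_mul, ← mul_add, ← Nat.cast_add]
      congr 3; ring
end ring
end WP

namespace WP
open Finset

theorem neg_rel {W : Type*} [Ring W] {x y : W} (h : y * x = x * y + 1) : x * (-y) = (-y) * x + 1 := by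
  rw [neg_mul, h]; noncomm_ring

section weyl
variable {R : Type} [CommRing R]

variable (R) in
/-- copy of the Weyl algebra with ring structure -/
def WA : Type := Weyl R

instance : Ring (WA R) := inferInstanceAs (Ring (Weyl R))
instance : Algebra R (WA R) := inferInstanceAs (Algebra R (Weyl R))

variable (R) in
def wx : WA R := Wx R
variable (R) in
def wy : WA R := Wy R

theorem wrel : wy R * wx R = wx R * wy R + 1 := by
  have := RingQuot.mkAlgHom_rel R (WeylRel.rel (K := R))
  rw [map_mul, map_add, map_mul, map_one] at this
  exact this

def wlift {A : Type*} [Semiring A] [Algebra R A] (x y : A) (h : y * x = x * y + 1) : WA R →ₐ[R] A :=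
  (RingQuot.liftAlgHom R ⟨FreeAlgebra.lift R ![x, y], by
    rintro _ _ ⟨⟩
    simpa using h⟩ : Weyl R →ₐ[R] A)

@[simp] theorem wlift_x {A : Type*} [Semiring A] [Algebra R A] (x y : A) (h : y * x = x * y + 1) :
    wlift (R := R) x y h (wx R) = x := by
  have : (RingQuot.liftAlgHom R ⟨FreeAlgebra.lift R ![x, y], by
    rintro _ _ ⟨⟩
    simpa using h⟩ : Weyl R →ₐ[R] A) (Wx R) = x := by simp [Wx]
  exact this

@[simp] theorem wlift_y {A : Type*} [Semiring A] [Algebra R A] (x y : A) (h : y * x = x * y + 1) :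
    wlift (R := R) x y h (wy R) = y := by
  have : (RingQuot.liftAlgHom R ⟨FreeAlgebra.lift R ![x, y], by
    rintro _ _ ⟨⟩
    simpa using h⟩ : Weyl R →ₐ[R] A) (Wy R) = y := by simp [Wy]
  exact this

theorem winduct {C : WA R → Prop} (hx : C (wx R)) (hy : C (wy R))
    (hr : ∀ r : R, C (algebraMap R _ r)) (ha : ∀ a b, C a → C b → C (a + b))
    (hm : ∀ a b, C a → C b → C (a * b)) (u : WA R) : C u := by
  obtain ⟨u, rfl⟩ := RingQuot.mkAlgHom_surjective R (WeylRel R) u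
  induction u using FreeAlgebra.induction with
  | grade0 r => rw [AlgHom.commutes]; exact hr r
  | grade1 i =>
    fin_cases i
    · exact hx
    · exact hy
  | mul a b h1 h2 => rw [map_mul]; exact hm _ _ h1 h2
  | add a b h1 h2 => rw [map_add]; exact ha _ _ h1 h2

theorem walg_ext {A : Type*} [Semiring A] [Algebra R A] {f g : WA R →ₐ[R] A}
    (hx : f (wx R) = g (wx R)) (hy : f (wy R) = g (wy R)) : f = g := by
  ext u
  induction u using winduct with
  | hx => exact hx
  | hy => exact hy
  | hr r => rw [AlgHom.commutes, AlgHom.commutes]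
  | ha a b h1 h2 => rw [map_add, map_add, h1, h2]
  | hm a b h1 h2 => rw [map_mul, map_mul, h1, h2]

variable (R) in
def repX : Module.End R (ℕ × ℕ →₀ R) :=
  Finsupp.linearCombination R (fun v : ℕ × ℕ => Finsupp.single (v.1+1, v.2) (1:R))

variable (R) in
def repY : Module.End R (ℕ × ℕ →₀ R) :=
  Finsupp.linearCombination R (fun v : ℕ × ℕ => Finsupp.single (v.1, v.2+1) (1:R)
    + (v.1 : R) • Finsupp.single (v.1-1, v.2) (1:R))

theorem repX_s (i j : ℕ) (r : R) : repX R (Finsupp.single (i,j) r) = Finsupp.single (i+1,j) r := by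
  simp [repX]

theorem repY_s (i j : ℕ) (r : R) : repY R (Finsupp.single (i,j) r) = Finsupp.single (i,j+1) r
   + Finsupp.single (i-1,j) (r * i) := by
  simp [repY]

theorem rep_rel : repY R * repX R = repX R * repY R + 1 := by
  apply Finsupp.lhom_ext
  rintro ⟨i, j⟩ r
  simp only [Module.End.mul_apply, LinearMap.add_apply, Module.End.one_apply, repX_s, repY_s, map_add]
  rcases i with _ | i
  · simp
  · simp only [Nat.add_sub_cancel, add_assoc]
    rw [← Finsupp.single_add]
    congr 2
    push_cast; ring

theorem rep_bas (i j : ℕ) : wlift (repX R) (repY R) rep_rel (wx R ^ i * wy R ^ j) (Finsupp.single (0,0) 1)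
    = Finsupp.single (i, j) 1 := by
  simp only [map_mul, map_pow, wlift_x, wlift_y, Module.End.mul_apply]
  have h1 : (repY R ^ j) (Finsupp.single (0,0) 1) = Finsupp.single (0,j) 1 := by
    induction j with
    | zero => simp
    | succ j ih => rw [pow_succ', Module.End.mul_apply, ih, repY_s]; simp
  rw [h1]
  induction i with
  | zero => simp
  | succ j ih => rw [pow_succ', Module.End.mul_apply, ih, repX_s]

variable (R) in
def wfam (v : ℕ × ℕ) : WA R := wx R ^ v.1 * wy R ^ v.2

theorem wfam_li : LinearIndependent R (wfam R) := by
  let ev : WA R →ₗ[R] (ℕ × ℕ →₀ R) :=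
    (LinearMap.applyₗ (R := R) (Finsupp.single ((0,0) : ℕ × ℕ) (1:R))).comp (wlift (repX R) (repY R) rep_rel).toLinearMap
  apply LinearIndependent.of_comp ev
  have : ev ∘ wfam R = fun v => Finsupp.single v 1 := by
    funext v
    exact rep_bas v.1 v.2
  rw [this]
  exact Finsupp.linearIndependent_single_one R _

theorem wfam_span : ⊤ ≤ Submodule.span R (Set.range (wfam R)) := by
  have key : ∀ a : WA R, ∀ s ∈ Submodule.span R (Set.range (wfam R)),
      a * s ∈ Submodule.span R (Set.range (wfam R)) := by
    intro a
    induction a using winduct with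
    | hx =>
      intro s hs
      induction hs using Submodule.span_induction with
      | mem s h =>
        obtain ⟨v, rfl⟩ := h
        refine Submodule.subset_span ⟨(v.1+1, v.2), ?_⟩
        simp [wfam, pow_succ', mul_assoc]
      | zero => simp
      | add a b _ _ h1 h2 => rw [mul_add]; exact Submodule.add_mem _ h1 h2
      | smul r a _ h1 => rw [mul_smul_comm]; exact Submodule.smul_mem _ _ h1
    | hy =>
      intro s hs
      induction hs using Submodule.span_induction with
      | mem s h =>
        obtain ⟨v, rfl⟩ := h
        have : wy R * wfam R v = wfam R (v.1, v.2+1) + (v.1 : R) • wfam R (v.1-1, v.2) := by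
          simp only [wfam]
          rw [← mul_assoc, rel_pow wrel, add_mul, Algebra.smul_def, map_natCast, mul_assoc, mul_assoc, pow_succ']
        rw [this]
        exact Submodule.add_mem _ (Submodule.subset_span ⟨_, rfl⟩) (Submodule.smul_mem _ _ (Submodule.subset_span ⟨_, rfl⟩))
      | zero => simp
      | add a b _ _ h1 h2 => rw [mul_add]; exact Submodule.add_mem _ h1 h2
      | smul r a _ h1 => rw [mul_smul_comm]; exact Submodule.smul_mem _ _ h1
    | hr r => intro s hs; rw [← Algebra.smul_def]; exact Submodule.smul_mem _ _ hs
    | ha a b h1 h2 => intro s hs; rw [add_mul]; exact Submodule.add_mem _ (h1 s hs) (h2 s hs)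
    | hm a b h1 h2 => intro s hs; rw [mul_assoc]; exact h1 _ (h2 _ hs)
  intro a _
  have := key a 1 (Submodule.subset_span ⟨(0,0), by simp [wfam]⟩)
  simpa using this

variable (R) in
def wbas : Module.Basis (ℕ × ℕ) R (WA R) := Module.Basis.mk wfam_li wfam_span

theorem wbas_apply (v : ℕ × ℕ) : wbas R v = wx R ^ v.1 * wy R ^ v.2 := by
  simp [wbas, wfam]

/-- base change -/
def wmap {R' : Type} [CommRing R'] (f : R →+* R') : WA R →+* WA R' :=
  letI : Algebra R (WA R') := ((algebraMap R' (WA R')).comp f).toAlgebra' (by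
    intro c x; exact Algebra.commutes (f c) x)
  (wlift (R := R) (wx R') (wy R') wrel).toRingHom

theorem wmap_x {R' : Type} [CommRing R'] (f : R →+* R') : wmap f (wx R) = wx R' := by
  let _ : Algebra R (WA R') := ((algebraMap R' (WA R')).comp f).toAlgebra' (by
    intro c x; exact Algebra.commutes (f c) x)
  exact wlift_x (R := R) (wx R') (wy R') wrel

theorem wmap_y {R' : Type} [CommRing R'] (f : R →+* R') : wmap f (wy R) = wy R' := by
  let _ : Algebra R (WA R') := ((algebraMap R' (WA R')).comp f).toAlgebra' (by
    intro c x; exact Algebra.commutes (f c) x)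
  exact wlift_y (R := R) (wx R') (wy R') wrel

theorem wmap_c {R' : Type} [CommRing R'] (f : R →+* R') (r : R) :
    wmap f (algebraMap R _ r) = algebraMap R' _ (f r) := by
  let _ : Algebra R (WA R') := ((algebraMap R' (WA R')).comp f).toAlgebra' (by
    intro c x; exact Algebra.commutes (f c) x)
  exact (wlift (R := R) (wx R') (wy R') wrel).commutes r

theorem wmap_smul {R' : Type} [CommRing R'] (f : R →+* R') (r : R) (u : WA R) :
    wmap f (r • u) = f r • wmap f u := by
  rw [Algebra.smul_def, map_mul, wmap_c, Algebra.smul_def]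

theorem wmap_repr {R' : Type} [CommRing R'] (f : R →+* R') (u : WA R) (v : ℕ × ℕ) :
    (wbas R').repr (wmap f u) v = f ((wbas R).repr u v) := by
  induction (wbas R).mem_span u using Submodule.span_induction with
  | zero => simp
  | add a b _ _ h1 h2 => simp [h1, h2]
  | smul r a _ h => simp [wmap_smul, h]
  | mem u hu =>
    obtain ⟨w, rfl⟩ := hu
    have : wmap f (wbas R w) = wbas R' w := by
      simp only [wbas_apply, map_mul, map_pow, wmap_x, wmap_y]
    rw [this]
    simp [Finsupp.single_apply, apply_ite f]

/-- the anti-involution -/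
def wβ0 : WA R →ₐ[R] (WA R)ᵐᵒᵖ :=
  wlift (MulOpposite.op (wx R)) (MulOpposite.op (-wy R)) (by
    apply MulOpposite.unop_injective
    change wx R * (-wy R) = (-wy R) * wx R + 1
    exact neg_rel wrel)

def wβ : WA R →ₗ[R] WA R :=
  (MulOpposite.opLinearEquiv R).symm.toLinearMap.comp (wβ0 (R := R)).toLinearMap

theorem wβ_mul (a b : WA R) : wβ (a * b) = wβ b * wβ a := by
  simp [wβ]
theorem wβ_one : wβ (1 : WA R) = 1 := by simp [wβ]
theorem wβ_pow (a : WA R) (n : ℕ) : wβ (a ^ n) = wβ a ^ n := by simp [wβ]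
theorem wβ_x : wβ (wx R) = wx R := by simp [wβ, wβ0]
theorem wβ_y : wβ (wy R) = - wy R := by simp [wβ, wβ0]
theorem wβ_c (r : R) : wβ (algebraMap R (WA R) r) = algebraMap R _ r := by
  rw [Algebra.algebraMap_eq_smul_one, map_smul, wβ_one]

theorem wmap_β {R' : Type} [CommRing R'] (f : R →+* R') (u : WA R) :
    wmap f (wβ u) = wβ (wmap f u) := by
  induction u using winduct with
  | hx => rw [wβ_x, wmap_x, wβ_x]
  | hy => rw [wβ_y, map_neg, wmap_y, wβ_y]
  | hr r => rw [wβ_c, wmap_c, wβ_c]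
  | ha a b h1 h2 => simp [h1, h2]
  | hm a b h1 h2 => simp [h1, h2, wβ_mul]

theorem wmap_inj {R' : Type} [CommRing R'] (f : R →+* R') (hf : Function.Injective f) :
    Function.Injective (wmap f) := by
  intro a b h
  apply (wbas R).repr.injective
  ext v
  apply hf
  rw [← wmap_repr, ← wmap_repr, h]

theorem wmap_range {R' : Type} [CommRing R'] (f : R →+* R') (u : WA R')
    (h : ∀ v, (wbas R').repr u v ∈ f.range) : ∃ u', wmap f u' = u := by
  choose c hc using h
  refine ⟨∑ v ∈ ((wbas R').repr u).support, c v • wbas R v, ?_⟩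
  conv_rhs => rw [← (wbas R').linearCombination_repr u]
  rw [map_sum, Finsupp.linearCombination_apply, Finsupp.sum]
  refine Finset.sum_congr rfl fun v _ => ?_
  rw [wmap_smul, hc]
  simp only [wbas_apply, map_mul, map_pow, wmap_x, wmap_y]

end weyl
end WP

namespace WP
open Finset

theorem mccoy {Z M ι : Type*} [CommRing Z] [AddCommGroup M] [Module Z M] [Fintype ι] [DecidableEq ι]
    (e : Module.Basis ι Z M) (v : ι → M) (hv : LinearIndependent Z v) (E : M →ₗ[Z] M)
    (hE : ∀ i, E (v i) = 0) : E = 0 := by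
  set A := e.toMatrix v with hA
  have h1 : LinearIndependent Z A.col := by
    have := hv.map' e.equivFun.toLinearMap e.equivFun.ker
    have e : A.col = ⇑e.equivFun.toLinearMap ∘ v := by
      funext j k; simp [hA, Module.Basis.toMatrix_apply, Matrix.col]
    rw [e]; exact this
  have h2 := Matrix.nonsingular_iff_det_mem_nonZeroDivisors.1 (Matrix.Nonsingular.of_linearIndependent_col h1)
  have h3 : ∀ i, A.det • e i = ∑ j, A.adjugate j i • v j := by
    intro i
    have : ∀ j, v j = ∑ k, A k j • e k := by
      intro j
      exact (e.sum_toMatrix_smul_self v j).symm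
    simp_rw [this, Finset.smul_sum, smul_smul]
    rw [Finset.sum_comm]
    simp_rw [← Finset.sum_smul]
    have : ∀ k, ∑ x, A.adjugate x i * A k x = (A * A.adjugate) k i := by
      intro k; rw [Matrix.mul_apply]; simp_rw [mul_comm]
    simp_rw [this, Matrix.mul_adjugate]
    simp [Matrix.smul_apply, Matrix.one_apply]
  apply e.ext
  intro i
  have h4 : A.det • E (e i) = 0 := by
    rw [← map_smul, h3, map_sum]
    simp [hE]
  apply e.repr.injective
  ext k
  have := congrArg (fun z => e.repr z k) h4
  simp only [map_smul, Finsupp.smul_apply, smul_eq_mul, map_zero, Finsupp.coe_zero, Pi.zero_apply] at this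
  simpa using (mul_left_mem_nonZeroDivisors_eq_zero_iff h2).1 this

section indep
variable {W : Type*} [Ring W]

theorem indep1 {a b : W} (h : b * a = a * b + 1) (p : ℕ)
    (hreg : ∀ n : ℕ, 0 < n → n < p → ∀ z : W, (n : W) * z = 0 → z = 0) (n : ℕ) (hn : n ≤ p) :
    ∀ d : ℕ → W, (∀ i, b * d i = d i * b) → ∑ i ∈ range n, a ^ i * d i = 0 → ∀ i < n, d i = 0 := by
  induction n with
  | zero => intro d _ _ i hi; omega
  | succ n ih =>
    intro d hd hs
    have e1 : ∑ i ∈ range n, a ^ i * (((i + 1 : ℕ) : W) * d (i+1)) = 0 := by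
      have h0 : b * (∑ i ∈ range (n+1), a ^ i * d i) - (∑ i ∈ range (n+1), a ^ i * d i) * b = 0 := by
        rw [hs]; simp
      rw [mul_sum, sum_mul, ← sum_sub_distrib, sum_range_succ'] at h0
      rw [← h0]
      simp only [pow_zero, one_mul, hd, sub_self, add_zero]
      refine sum_congr rfl fun i _ => ?_
      rw [← mul_assoc b, rel_pow h, add_mul, mul_assoc _ b, hd, Nat.add_sub_cancel, ← mul_assoc (a ^ i),
        ← (Nat.cast_commute (i+1) (a ^ i)).eq]
      noncomm_ring
    have e2 := ih (by omega) (fun i => ((i + 1 : ℕ) : W) * d (i+1)) (fun i => by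
      rw [← mul_assoc, ← (Nat.cast_commute (i+1) b).eq, mul_assoc, hd, mul_assoc]) e1
    have e3 : ∀ i < n, d (i+1) = 0 := fun i hi => hreg (i+1) (by omega) (by omega) _ (e2 i hi)
    intro i hi
    rcases i with _ | i
    · rw [sum_range_succ', sum_eq_zero] at hs
      · simpa using hs
      · intro i hi; rw [e3 i (by simpa using hi), mul_zero]
    · exact e3 i (by omega)

theorem indep2 {a b : W} (h : b * a = a * b + 1) (p : ℕ)
    (hreg : ∀ n : ℕ, 0 < n → n < p → ∀ z : W, (n : W) * z = 0 → z = 0)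
    (c : ℕ → ℕ → W) (hc : ∀ i j z, z * c i j = c i j * z)
    (hs : ∑ i ∈ range p, ∑ j ∈ range p, c i j * (a ^ i * b ^ j) = 0) : ∀ i < p, ∀ j < p, c i j = 0 := by
  have h1 := indep1 h p hreg p le_rfl (fun i => ∑ j ∈ range p, c i j * b ^ j) (by
    intro i
    rw [mul_sum, sum_mul]
    refine sum_congr rfl fun j _ => ?_
    rw [← mul_assoc, hc, mul_assoc, mul_assoc, ← pow_succ, ← pow_succ']) (by
    rw [← hs]
    refine sum_congr rfl fun i _ => ?_
    rw [mul_sum]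
    refine sum_congr rfl fun j _ => ?_
    rw [← mul_assoc, hc, mul_assoc])
  intro i hi
  refine indep1 (a := b) (b := -a) ?_ p hreg p le_rfl (fun j => c i j) (fun j => (hc _ _ _)) ?_
  · rw [mul_neg, h]; noncomm_ring
  · rw [← h1 i hi]
    exact sum_congr rfl fun j _ => hc _ _ _
end indep

section charp
variable {R : Type} [CommRing R]

theorem unit_of_lt {p : ℕ} (hp : p.Prime) (h0 : (p : R) = 0) (n : ℕ) (hn : ¬ p ∣ n) :
    ∃ m : ℕ, (m : R) * (n : R) = 1 := by
  have hc : Nat.Coprime n p := ((Nat.Prime.coprime_iff_not_dvd hp).2 hn).symm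
  have := Int.gcd_eq_gcd_ab n p
  have h1 : ((n : ℤ) * Int.gcdA n p + p * Int.gcdB n p : ℤ) = 1 := by
    rw [← this]; simpa using hc
  have h2 := congrArg (Int.cast : ℤ → R) h1
  push_cast at h2
  rw [h0, zero_mul, add_zero] at h2
  refine ⟨(Int.gcdA n p % p).toNat, ?_⟩
  have h3 : (((Int.gcdA n p % p).toNat : ℕ) : ℤ) = Int.gcdA n p % p :=
    Int.toNat_of_nonneg (Int.emod_nonneg _ (by have := hp.pos; omega))
  have h4 : (((Int.gcdA n p % p).toNat : ℕ) : R) = ((Int.gcdA n p : ℤ) : R) := by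
    have h5 := congrArg (Int.cast : ℤ → R) (Int.emod_add_mul_ediv (Int.gcdA n p) p)
    push_cast at h5
    rw [h0, zero_mul, add_zero] at h5
    rw [← h5, ← Int.cast_natCast, h3]
  rw [h4, mul_comm, h2]

theorem reg_of_lt {p : ℕ} (hp : p.Prime) (h0 : (p : R) = 0) {W : Type*} [Ring W] [Algebra R W]
   (n : ℕ) (hn : ¬ p ∣ n) (z : W) (hz : (n : W) * z = 0) : z = 0 := by
  obtain ⟨m, hm⟩ := unit_of_lt hp h0 n hn
  have := congrArg (algebraMap R W) hm
  simp only [map_mul, map_natCast, map_one] at this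
  rw [← one_mul z, ← this, mul_assoc, hz, mul_zero]

variable {p : ℕ}

theorem castW (h0 : (p : R) = 0) : (p : WA R) = 0 := by
  have := congrArg (algebraMap R (WA R)) h0
  simpa using this

theorem gen_comm (u : WA R) (hx : Commute u (wx R)) (hy : Commute u (wy R)) (z : WA R) : Commute u z := by
  induction z using winduct with
  | hx => exact hx
  | hy => exact hy
  | hr r => exact (Algebra.commute_algebraMap_right r u)
  | ha a b h1 h2 => exact h1.add_right h2
  | hm a b h1 h2 => exact h1.mul_right h2

theorem wxp_comm (h0 : (p : R) = 0) (z : WA R) : Commute (wx R ^ p) z := by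
  apply gen_comm
  · exact (Commute.refl _).pow_left _
  · have := rel_pow (wrel (R := R)) p
    rw [castW h0, zero_mul, add_zero] at this
    exact this.symm

theorem wyp_comm (h0 : (p : R) = 0) (z : WA R) : Commute (wy R ^ p) z := by
  apply gen_comm
  · have := rel_pow' (wrel (R := R)) p
    rw [castW h0, zero_mul, add_zero] at this
    exact this
  · exact (Commute.refl _).pow_left _

variable (R) in
abbrev ZW := Subalgebra.center R (WA R)

theorem zli (hp : p.Prime) (h0 : (p : R) = 0) {A B : WA R} (h : B * A = A * B + 1) :
    LinearIndependent (ZW R) (fun v : Fin p × Fin p => A ^ (v.1 : ℕ) * B ^ (v.2 : ℕ)) := by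
  rw [Fintype.linearIndependent_iff]
  intro g hg
  let c : ℕ → ℕ → WA R := fun i j => if h : i < p ∧ j < p then (g (⟨i, h.1⟩, ⟨j, h.2⟩) : WA R) else 0
  have := indep2 h p (fun n h1 h2 z hz => reg_of_lt hp h0 n (fun hd => by
    have := Nat.le_of_dvd h1 hd; omega) z hz) c (by
      intro i j z
      simp only [c]
      split_ifs with hh
      · exact (Subalgebra.mem_center_iff.1 (g (⟨i, hh.1⟩, ⟨j, hh.2⟩)).2 z)
      · simp) (by
      rw [← hg, Fintype.sum_prod_type, Finset.sum_range]
      refine Finset.sum_congr rfl fun i _ => ?_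
      rw [Finset.sum_range]
      refine Finset.sum_congr rfl fun j _ => ?_
      simp [c, Subalgebra.smul_def])
  rintro ⟨i, j⟩
  have h2 := this i i.2 j j.2
  simpa [c] using h2

theorem zspan (hp : p.Prime) (h0 : (p : R) = 0) :
    ⊤ ≤ Submodule.span (ZW R) (Set.range (fun v : Fin p × Fin p => wx R ^ (v.1 : ℕ) * wy R ^ (v.2 : ℕ))) := by
  intro u _
  induction (wbas R).mem_span u using Submodule.span_induction with
  | zero => exact Submodule.zero_mem _
  | add a b _ _ h1 h2 => exact Submodule.add_mem _ (h1 trivial) (h2 trivial)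
  | smul r a _ h =>
    have : r • a = (algebraMap R (ZW R) r) • a := by
      rw [Subalgebra.smul_def, Algebra.smul_def]; rfl
    rw [this]
    exact Submodule.smul_mem _ _ (h trivial)
  | mem u hu =>
    obtain ⟨w, rfl⟩ := hu
    have hx : wx R ^ p ∈ ZW R := Subalgebra.mem_center_iff.2 fun b => ((wxp_comm h0 b).eq).symm
    have hy : wy R ^ p ∈ ZW R := Subalgebra.mem_center_iff.2 fun b => ((wyp_comm h0 b).eq).symm
    have e : wbas R w = ((⟨wx R ^ p, hx⟩ : ZW R) ^ (w.1 / p) * (⟨wy R ^ p, hy⟩ : ZW R) ^ (w.2 / p)) •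
       (wx R ^ (w.1 % p) * wy R ^ (w.2 % p)) := by
      rw [wbas_apply, Subalgebra.smul_def]
      simp only [MulMemClass.coe_mul, SubmonoidClass.coe_pow, smul_eq_mul]
      conv_lhs => rw [← Nat.div_add_mod w.1 p, ← Nat.div_add_mod w.2 p, pow_add, pow_add, pow_mul, pow_mul]
      have := ((wyp_comm h0 (wx R ^ (w.1 % p))).pow_left (w.2/p)).eq
      rw [mul_assoc, ← mul_assoc (wx R ^ (w.1 % p)), ← this]
      simp only [mul_assoc]
    rw [e]
    refine Submodule.smul_mem _ _ (Submodule.subset_span ⟨(⟨w.1 % p, Nat.mod_lt _ hp.pos⟩, ⟨w.2 % p, Nat.mod_lt _ hp.pos⟩), rfl⟩)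

theorem pow_p_central (hp : p.Prime) (h0 : (p : R) = 0) {A B : WA R} (h : B * A = A * B + 1)
    (C : WA R) (h1 : Commute C A) (h2 : Commute C B) (z : WA R) : Commute C z := by
  let E : WA R →ₗ[ZW R] WA R := {
      toFun := fun z => C * z - z * C
      map_add' := fun a b => by noncomm_ring
      map_smul' := fun r a => by
        have := Subalgebra.mem_center_iff.1 r.2 C
        simp only [Subalgebra.smul_def, RingHom.id_apply, smul_eq_mul]
        rw [← mul_assoc, this, mul_sub, mul_assoc, mul_assoc] }
  have := mccoy (Module.Basis.mk (zli hp h0 wrel) (zspan hp h0)) _ (zli hp h0 h) E (by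
    rintro ⟨i, j⟩
    change C * (A ^ (i:ℕ) * B ^ (j:ℕ)) - (A ^ (i:ℕ) * B ^ (j:ℕ)) * C = 0
    rw [sub_eq_zero]
    exact ((h1.pow_right _).mul_right (h2.pow_right _)).eq)
  have h3 := LinearMap.congr_fun this z
  exact sub_eq_zero.1 h3

theorem repr_adY (u : WA R) (i j : ℕ) :
    (wbas R).repr (wy R * u - u * wy R) (i, j) = (i + 1 : ℕ) * (wbas R).repr u (i+1, j) := by
  induction (wbas R).mem_span u using Submodule.span_induction with
  | zero => simp
  | add a b _ _ h1 h2 =>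
    have : wy R * (a + b) - (a + b) * wy R = (wy R * a - a * wy R) + (wy R * b - b * wy R) := by noncomm_ring
    rw [this, map_add, map_add, Finsupp.add_apply, Finsupp.add_apply, h1, h2, mul_add]
  | smul r a _ h =>
    have : wy R * (r • a) - (r • a) * wy R = r • (wy R * a - a * wy R) := by
      rw [mul_smul_comm, smul_mul_assoc, smul_sub]
    rw [this, map_smul, map_smul, Finsupp.smul_apply, Finsupp.smul_apply, h, smul_eq_mul, smul_eq_mul]; ring
  | mem u hu =>
    obtain ⟨w, rfl⟩ := hu
    have : wy R * wbas R w - wbas R w * wy R = (w.1 : R) • wbas R (w.1 - 1, w.2) := by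
      rw [wbas_apply, wbas_apply, ← mul_assoc, rel_pow wrel, Algebra.smul_def, map_natCast, add_mul,
        mul_assoc, mul_assoc, mul_assoc, ← pow_succ, ← pow_succ', add_sub_cancel_left]
    rw [this, map_smul, (wbas R).repr_self, (wbas R).repr_self]
    obtain ⟨k, l⟩ := w
    rcases k with _ | k
    · simp
    · simp only [Finsupp.smul_apply, Finsupp.single_apply, Nat.add_sub_cancel, Prod.mk.injEq, add_left_inj, smul_eq_mul]
      split_ifs with h
      · rw [h.1]
      · simp

theorem repr_adX (u : WA R) (i j : ℕ) :
    (wbas R).repr (u * wx R - wx R * u) (i, j) = (j + 1 : ℕ) * (wbas R).repr u (i, j+1) := by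
  induction (wbas R).mem_span u using Submodule.span_induction with
  | zero => simp
  | add a b _ _ h1 h2 =>
    have : (a + b) * wx R - wx R * (a + b) = (a * wx R - wx R * a) + (b * wx R - wx R * b) := by noncomm_ring
    rw [this, map_add, map_add, Finsupp.add_apply, Finsupp.add_apply, h1, h2, mul_add]
  | smul r a _ h =>
    have : (r • a) * wx R - wx R * (r • a) = r • (a * wx R - wx R * a) := by
      rw [mul_smul_comm, smul_mul_assoc, smul_sub]
    rw [this, map_smul, map_smul, Finsupp.smul_apply, Finsupp.smul_apply, h, smul_eq_mul, smul_eq_mul]; ring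
  | mem u hu =>
    obtain ⟨w, rfl⟩ := hu
    have : wbas R w * wx R - wx R * wbas R w = (w.2 : R) • wbas R (w.1, w.2 - 1) := by
      rw [wbas_apply, wbas_apply, mul_assoc, rel_pow' wrel, Algebra.smul_def, map_natCast, mul_add,
        ← mul_assoc, ← mul_assoc, ← mul_assoc, ← pow_succ, ← pow_succ', add_sub_cancel_left, ← mul_assoc,
        (Nat.cast_commute w.2 (wx R ^ w.1)).eq]
    rw [this, map_smul, (wbas R).repr_self, (wbas R).repr_self]
    obtain ⟨k, l⟩ := w
    rcases l with _ | l
    · simp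
    · simp only [Finsupp.smul_apply, Finsupp.single_apply, Nat.add_sub_cancel, Prod.mk.injEq, add_left_inj, smul_eq_mul]
      split_ifs with h
      · rw [h.2]
      · simp

theorem central_supp (hp : p.Prime) (h0 : (p : R) = 0) (u : WA R) (hu : ∀ z, Commute u z) (i j : ℕ)
    (hij : ¬ (p ∣ i ∧ p ∣ j)) : (wbas R).repr u (i, j) = 0 := by
  have key : ∀ n : ℕ, ¬ p ∣ n → ∀ r : R, (n : R) * r = 0 → r = 0 := fun n hn r hr => by
    obtain ⟨m, hm⟩ := unit_of_lt hp h0 n hn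
    rw [← one_mul r, ← hm, mul_assoc, hr, mul_zero]
  by_cases hi : p ∣ i
  · have hj : ¬ p ∣ j := fun h => hij ⟨hi, h⟩
    obtain ⟨j, rfl⟩ : ∃ k, j = k + 1 := ⟨j - 1, by
      rcases j with _ | j
      · simp at hj
      · simp⟩
    apply key _ hj
    rw [← repr_adX, (hu (wx R)).eq, sub_self]; simp
  · obtain ⟨i, rfl⟩ : ∃ k, i = k + 1 := ⟨i - 1, by
      rcases i with _ | j
      · simp at hi
      · simp⟩
    apply key _ hi
    rw [← repr_adY, ← (hu (wy R)).eq, sub_self]; simp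
end charp
end WP

namespace WP
open Finset

section filt
variable {R : Type} [CommRing R]

variable (R) in
def FS (s : Set (ℕ × ℕ)) : Submodule R (WA R) := Submodule.span R (wbas R '' s)

theorem mem_FS {s : Set (ℕ × ℕ)} {u : WA R} : u ∈ FS R s ↔ ∀ v, (wbas R).repr u v ≠ 0 → v ∈ s := by
  rw [FS, Module.Basis.mem_span_image]
  constructor
  · intro h v hv; exact h (by simpa using hv)
  · intro h v hv; exact h v (by simpa using hv)

theorem FS_mono {s t : Set (ℕ × ℕ)} (h : s ⊆ t) : FS R s ≤ FS R t :=
  Submodule.span_mono (Set.image_mono h)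

theorem bas_mem {s : Set (ℕ × ℕ)} {v} (h : v ∈ s) : wbas R v ∈ FS R s :=
  Submodule.subset_span ⟨v, h, rfl⟩

theorem bas_mul (v v' : ℕ × ℕ) : wbas R v * wbas R v' = ∑ r ∈ range (v.2 + 1),
    ((v.2.choose r * v'.1.descFactorial r : ℕ) : R) • wbas R (v.1 + (v'.1 - r), (v.2 - r) + v'.2) := by
  rw [wbas_apply, wbas_apply, mul_assoc, ← mul_assoc (wy R ^ v.2), rel_pow_pow wrel, sum_mul, mul_sum]
  refine sum_congr rfl fun r _ => ?_
  rw [wbas_apply, Algebra.smul_def, map_natCast, pow_add, pow_add]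
  rw [mul_assoc, ← mul_assoc (wx R ^ v.1), ← (Nat.cast_commute _ (wx R ^ v.1)).eq]
  simp only [mul_assoc]

theorem FS_mul {s t q : Set (ℕ × ℕ)}
    (H : ∀ v ∈ s, ∀ v' ∈ t, ∀ r, r ≤ v.2 → r ≤ v'.1 → (v.1 + (v'.1 - r), (v.2 - r) + v'.2) ∈ q)
    {u u' : WA R} (hu : u ∈ FS R s) (hu' : u' ∈ FS R t) : u * u' ∈ FS R q := by
  have : FS R s * FS R t ≤ FS R q := by
    rw [FS, FS, Submodule.span_mul_span, Submodule.span_le]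
    rintro _ ⟨_, ⟨v, hv, rfl⟩, _, ⟨v', hv', rfl⟩, rfl⟩
    simp only [bas_mul]
    refine Submodule.sum_mem _ fun r hr => ?_
    have hr' : r ≤ v.2 := by simpa [Nat.lt_succ_iff] using hr
    by_cases h : r ≤ v'.1
    · exact Submodule.smul_mem _ _ (bas_mem (H v hv v' hv' r hr' h))
    · rw [Nat.descFactorial_of_lt (by omega)]; simp
  exact this (Submodule.mul_mem_mul hu hu')

theorem FS_deg_pow {u : WA R} {d : ℕ} (hu : u ∈ FS R {v | v.1 + v.2 ≤ d}) (n : ℕ) :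
    u ^ n ∈ FS R {v | v.1 + v.2 ≤ n * d} := by
  induction n with
  | zero =>
    have : (u : WA R) ^ 0 = wbas R (0,0) := by simp [wbas_apply]
    rw [this]; exact bas_mem (by simp)
  | succ n ih =>
    rw [pow_succ]
    refine FS_mul ?_ ih hu
    intro v hv v' hv' r h1 h2
    simp only [Set.mem_ofPred_eq] at *
    rw [add_mul, one_mul]; omega

theorem lead_mul (M : ℕ) (v0 v1 : ℕ × ℕ) (g g' : R) (u u' : WA R)
    (hu : u - g • wbas R v0 ∈ FS R {v | v.1 + M * v.2 < v0.1 + M * v0.2})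
    (hu' : u' - g' • wbas R v1 ∈ FS R {v | v.1 + M * v.2 < v1.1 + M * v1.2}) :
    u * u' - (g * g') • wbas R (v0 + v1) ∈ FS R {v | v.1 + M * v.2 < (v0 + v1).1 + M * (v0 + v1).2} := by
  have e : u * u' - (g * g') • wbas R (v0 + v1) =
      (u - g • wbas R v0) * (u' - g' • wbas R v1) + (u - g • wbas R v0) * (g' • wbas R v1)
      + (g • wbas R v0) * (u' - g' • wbas R v1) + (g * g') • (wbas R v0 * wbas R v1 - wbas R (v0 + v1)) := by
    rw [smul_sub, ← smul_mul_smul_comm]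
    noncomm_ring
  have aux : ∀ (s t : Set (ℕ × ℕ)) (c d : ℕ), (∀ v ∈ s, ∀ v' ∈ t, v.1 + M * v.2 + (v'.1 + M * v'.2) < (v0 + v1).1 + M * (v0 + v1).2) →
     ∀ v ∈ s, ∀ v' ∈ t, ∀ r, r ≤ v.2 → r ≤ v'.1 → (v.1 + (v'.1 - r), (v.2 - r) + v'.2) ∈ {v | v.1 + M * v.2 < (v0 + v1).1 + M * (v0 + v1).2} := by
    intro s t c d H v hv v' hv' r h1 h2
    refine lt_of_le_of_lt ?_ (H v hv v' hv')
    simp only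
    have : M * (v.2 - r + v'.2) ≤ M * v.2 + M * v'.2 := by
      rw [← mul_add]; exact Nat.mul_le_mul_left _ (by omega)
    omega
  have hs : (v0 + v1).1 + M * (v0 + v1).2 = v0.1 + M * v0.2 + (v1.1 + M * v1.2) := by
    simp only [Prod.fst_add, Prod.snd_add]; ring
  have b0 : g • wbas R v0 ∈ FS R {v0} := Submodule.smul_mem _ _ (bas_mem rfl)
  have b1 : g' • wbas R v1 ∈ FS R {v1} := Submodule.smul_mem _ _ (bas_mem rfl)
  rw [e]
  refine Submodule.add_mem _ (Submodule.add_mem _ (Submodule.add_mem _ ?_ ?_) ?_) ?_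
  · refine FS_mul (aux _ _ 0 0 ?_) hu hu'
    intro v hv v' hv'
    simp only [Set.mem_ofPred_eq] at hv hv'
    omega
  · refine FS_mul (aux _ _ 0 0 ?_) hu b1
    intro v hv v' hv'
    simp only [Set.mem_ofPred_eq, Set.mem_singleton_iff] at hv hv'
    subst hv'
    omega
  · refine FS_mul (aux _ _ 0 0 ?_) b0 hu'
    intro v hv v' hv'
    simp only [Set.mem_ofPred_eq, Set.mem_singleton_iff] at hv hv'
    subst hv
    omega
  · apply Submodule.smul_mem
    rw [bas_mul, sum_range_succ']
    simp only [Nat.choose_zero_right, Nat.descFactorial_zero, mul_one, Nat.cast_one, one_smul, Nat.sub_zero]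
    rw [show (v0 + v1 : ℕ × ℕ) = (v0.1 + v1.1, v0.2 + v1.2) from rfl, add_sub_cancel_right]
    refine Submodule.sum_mem _ fun r hr => ?_
    have hr' : r < v0.2 := by simpa using hr
    by_cases h : r + 1 ≤ v1.1
    · refine Submodule.smul_mem _ _ (bas_mem ?_)
      simp only [Set.mem_ofPred_eq]
      have : M * (v0.2 - (r+1) + v1.2) ≤ M * (v0.2 + v1.2) := Nat.mul_le_mul_left _ (by omega)
      omega
    · rw [Nat.descFactorial_of_lt (by omega)]; simp

theorem lead_pow (M : ℕ) (v0 : ℕ × ℕ) (g : R) (u : WA R)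
    (hu : u - g • wbas R v0 ∈ FS R {v | v.1 + M * v.2 < v0.1 + M * v0.2}) (n : ℕ) :
    u ^ n - g ^ n • wbas R (n • v0) ∈ FS R {v | v.1 + M * v.2 < (n • v0).1 + M * (n • v0).2} := by
  induction n with
  | zero =>
    have : u ^ 0 - g ^ 0 • wbas R (0 • v0) = 0 := by simp [wbas_apply]
    rw [this]; exact Submodule.zero_mem _
  | succ n ih =>
    rw [pow_succ, pow_succ, succ_nsmul]
    exact lead_mul M _ _ _ _ _ _ ih hu

theorem lead_coeff (M : ℕ) (v0 : ℕ × ℕ) (u : WA R)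
    (hu : ∀ v, (wbas R).repr u v ≠ 0 → v ≠ v0 → v.1 + M * v.2 < v0.1 + M * v0.2) (n : ℕ) :
    (wbas R).repr (u ^ n) (n • v0) = ((wbas R).repr u v0) ^ n := by
  set g := (wbas R).repr u v0 with hg
  have h1 : u - g • wbas R v0 ∈ FS R {v | v.1 + M * v.2 < v0.1 + M * v0.2} := by
    rw [mem_FS]
    intro v hv
    rw [map_sub, map_smul, (wbas R).repr_self, Finsupp.sub_apply, Finsupp.smul_apply, Finsupp.single_apply] at hv
    split_ifs at hv with h
    · subst h; simp [hg] at hv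
    · simp only [smul_eq_mul, mul_zero, sub_zero] at hv
      exact hu v hv (fun h' => h h'.symm)
  have h2 := lead_pow M v0 g u h1 n
  rw [mem_FS] at h2
  by_contra hne
  have h3 := h2 (n • v0) (by
    rw [map_sub, map_smul (wbas R).repr, (wbas R).repr_self, Finsupp.sub_apply, Finsupp.smul_apply, Finsupp.single_eq_same,
      smul_eq_mul, mul_one]
    exact sub_ne_zero.2 hne)
  simp at h3
end filt
end WP

namespace WP
open Finset

section br
variable {R : Type} [CommRing R]

def evl (p : ℕ) : (ℕ × ℕ →₀ R) →ₗ[R] WA R :=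
  Finsupp.linearCombination R (fun v => wbas R (p * v.1, p * v.2))

def br : (ℕ × ℕ →₀ R) →ₗ[R] (ℕ × ℕ →₀ R) →ₗ[R] (ℕ × ℕ →₀ R) :=
  Finsupp.linearCombination R (fun v => Finsupp.linearCombination R (fun v' =>
    Finsupp.single (v + v' - (1,1)) (((v.2 * v'.1 : ℕ) : R) - ((v'.2 * v.1 : ℕ) : R))))

theorem br_single (v v' : ℕ × ℕ) (r r' : R) : br (Finsupp.single v r) (Finsupp.single v' r') =
   Finsupp.single (v + v' - (1,1)) (r * r' * (((v.2 * v'.1 : ℕ) : R) - ((v'.2 * v.1 : ℕ) : R))) := by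
  simp only [br, Finsupp.linearCombination_single, LinearMap.smul_apply, Finsupp.smul_single, smul_eq_mul, mul_assoc]

theorem evl_single (p : ℕ) (v : ℕ × ℕ) (r : R) : evl p (Finsupp.single v r) = r • ((wx R ^ p) ^ v.1 * (wy R ^ p) ^ v.2) := by
  simp [evl, wbas_apply, pow_mul]

theorem evl_br {p : ℕ} (hp : p.Prime) (h2 : (p : R) ^ 2 = 0) (b a : ℕ × ℕ →₀ R) :
    evl p b * evl p a - evl p a * evl p b = (p.factorial : WA R) * evl p (br b a) := by
  have h2W : (p : WA R) ^ 2 = 0 := by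
    have := congrArg (algebraMap R (WA R)) h2
    simpa using this
  have hc : ∀ z : WA R, (p.factorial : WA R) * z = z * (p.factorial : WA R) := fun z => (Nat.cast_commute _ z).eq
  have hc2 : (p.factorial : WA R) * (p.factorial : WA R) = 0 := by
    obtain ⟨c, hc⟩ := Nat.dvd_factorial hp.pos le_rfl
    have : (p.factorial : WA R) * (p.factorial : WA R) = (p : WA R) ^ 2 * ((c * c : ℕ) : WA R) := by
      rw [← Nat.cast_mul, ← Nat.cast_pow, ← Nat.cast_mul]
      congr 1
      rw [hc]; ring
    rw [this, h2W, zero_mul]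
  have hST := pp_of_sq (wrel (R := R)) p hp h2W
  have hcomm := comm_pow_of_sq hc hc2 hST
  set S := wx R ^ p
  set T := wy R ^ p
  set c : WA R := (p.factorial : WA R)
  have hmul : ∀ v v' : ℕ × ℕ, (S ^ v.1 * T ^ v.2) * (S ^ v'.1 * T ^ v'.2) =
      S ^ (v.1 + v'.1) * T ^ (v.2 + v'.2) +
      c * (((v.2 * v'.1 : ℕ) : R) • (S ^ (v.1 + v'.1 - 1) * T ^ (v.2 + v'.2 - 1))) := by
    intro v v'
    have e1 : (S ^ v.1 * T ^ v.2) * (S ^ v'.1 * T ^ v'.2) = S ^ v.1 * (T ^ v.2 * S ^ v'.1) * T ^ v'.2 := by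
      simp only [mul_assoc]
    rw [e1, hcomm, mul_add, add_mul, pow_add, pow_add]
    congr 1
    · simp only [mul_assoc]
    · by_cases h : v.2 * v'.1 = 0
      · rw [h]; simp
      · have h1 : v.2 ≠ 0 := left_ne_zero_of_mul h
        have h3 : v'.1 ≠ 0 := right_ne_zero_of_mul h
        rw [show v.1 + v'.1 - 1 = v.1 + (v'.1 - 1) by omega, show v.2 + v'.2 - 1 = (v.2 - 1) + v'.2 by omega,
          pow_add, pow_add, Algebra.smul_def, map_natCast, mul_assoc c, ← mul_assoc (S ^ v.1), ← hc,
          ← mul_assoc (S ^ v.1 * _)]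
        generalize v.2 * v'.1 = n
        have := (Nat.cast_commute n (S ^ v.1)).eq
        simp only [mul_assoc]
        rw [← mul_assoc (S ^ v.1) (n : WA R), ← this]
        simp only [mul_assoc]
  induction b using Finsupp.induction_linear with
  | zero => simp
  | add b b' h1 h2 =>
    rw [map_add, map_add, LinearMap.add_apply, map_add, mul_add c, ← h1, ← h2]; noncomm_ring
  | single v r =>
    induction a using Finsupp.induction_linear with
    | zero => simp
    | add b b' h1 h2 =>
      rw [map_add, map_add, map_add, mul_add c, ← h1, ← h2]; noncomm_ring
    | single v' r' =>
      rw [br_single, evl_single, evl_single, evl_single, smul_mul_smul_comm, smul_mul_smul_comm, hmul, hmul,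
        mul_comm r' r, ← smul_sub, add_comm v'.1, add_comm v'.2, add_sub_add_left_eq_sub]
      change _ = c * ((r * r' * (((v.2 * v'.1 : ℕ) : R) - ((v'.2 * v.1 : ℕ) : R))) •
        (S ^ (v.1 + v'.1 - 1) * T ^ (v.2 + v'.2 - 1)))
      simp only [mul_smul_comm, ← sub_smul, smul_smul]

theorem wmap_bas {R' : Type} [CommRing R'] (f : R →+* R') (v : ℕ × ℕ) :
    wmap f (wbas R v) = wbas R' v := by
  rw [wbas_apply, wbas_apply, map_mul, map_pow, map_pow, wmap_x, wmap_y]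

def fmap {R' : Type} [CommRing R'] (f : R →+* R') : (ℕ × ℕ →₀ R) →+ (ℕ × ℕ →₀ R') :=
  Finsupp.mapRange.addMonoidHom (f : R →+ R')

theorem fmap_apply {R' : Type} [CommRing R'] (f : R →+* R') (a : ℕ × ℕ →₀ R) (v) : fmap f a v = f (a v) := by
  simp [fmap]

theorem fmap_single {R' : Type} [CommRing R'] (f : R →+* R') (v : ℕ × ℕ) (r : R) :
    fmap f (Finsupp.single v r) = Finsupp.single v (f r) := by
  simp [fmap]

theorem fmap_br {R' : Type} [CommRing R'] (f : R →+* R') (b a : ℕ × ℕ →₀ R) :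
    fmap f (br b a) = br (fmap f b) (fmap f a) := by
  induction b using Finsupp.induction_linear with
  | zero => simp
  | add b b' h1 h2 => simp [h1, h2]
  | single v r =>
    induction a using Finsupp.induction_linear with
    | zero => simp
    | add b b' h1 h2 => simp [h1, h2]
    | single v' r' =>
      rw [br_single, fmap_single, fmap_single, fmap_single, br_single]
      congr 1
      simp only [map_mul, map_sub, map_natCast]

theorem wmap_evl {R' : Type} [CommRing R'] (f : R →+* R') (p : ℕ) (a : ℕ × ℕ →₀ R) :
    wmap f (evl p a) = evl p (fmap f a) := by
  induction a using Finsupp.induction_linear with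
  | zero => simp
  | add b b' h1 h2 => simp [h1, h2]
  | single v r =>
    rw [fmap_single, evl, evl, Finsupp.linearCombination_single, Finsupp.linearCombination_single, wmap_smul, wmap_bas]

theorem ring_aux {W : Type*} [Ring W] (P Ea Eb U V c : W) (hP : ∀ z, P * z = z * P) (hPP : P * P = 0)
    (h1 : P * (V * Ea - Ea * V) = 0) (h2 : P * (Eb * U - U * Eb) = 0)
    (h : (Eb + P * V) * (Ea + P * U) = (Ea + P * U) * (Eb + P * V) + c) : Eb * Ea - Ea * Eb = c := by
  have e1 : ∀ z t : W, z * (P * t) = P * (z * t) := fun z t => by rw [← mul_assoc, ← hP, mul_assoc]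
  have e2 : (Eb + P * V) * (Ea + P * U) = Eb * Ea + P * (Eb * U) + P * (V * Ea) := by
    have : (Eb + P * V) * (Ea + P * U) = Eb * Ea + Eb * (P * U) + P * (V * Ea) + P * (V * (P * U)) := by noncomm_ring
    rw [this, e1, e1, ← mul_assoc P P, hPP, zero_mul, add_zero]
  have e3 : (Ea + P * U) * (Eb + P * V) = Ea * Eb + P * (Ea * V) + P * (U * Eb) := by
    have : (Ea + P * U) * (Eb + P * V) = Ea * Eb + Ea * (P * V) + P * (U * Eb) + P * (U * (P * V)) := by noncomm_ring
    rw [this, e1, e1, ← mul_assoc P P, hPP, zero_mul, add_zero]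
  rw [e2, e3] at h
  rw [mul_sub, sub_eq_zero] at h1 h2
  rw [h1, h2] at h
  have h' : Eb * Ea + (P * (U * Eb) + P * (Ea * V)) = (Ea * Eb + c) + (P * (U * Eb) + P * (Ea * V)) := by
    rw [← add_assoc, h]; abel
  rw [add_right_cancel h']; abel

theorem exists_mul_of_wmap (n : ℕ) (u : WA R) (h : ∀ v, ∃ c, (wbas R).repr u v = n * c) : ∃ u', u = (n : WA R) * u' := by
  choose c hc using h
  refine ⟨∑ v ∈ ((wbas R).repr u).support, c v • wbas R v, ?_⟩
  conv_lhs => rw [← (wbas R).linearCombination_repr u]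
  rw [Finsupp.linearCombination_apply, Finsupp.sum, mul_sum]
  refine Finset.sum_congr rfl fun v _ => ?_
  rw [hc, mul_smul, Algebra.smul_def (n : R), map_natCast]

theorem mk_zero_iff (n : ℕ) (r : R) :
    Ideal.Quotient.mk (Ideal.span {(n : R)}) r = 0 ↔ ∃ c, r = n * c := by
  rw [Ideal.Quotient.eq_zero_iff_mem, Ideal.mem_span_singleton]; rfl

theorem wmap_zero (n : ℕ) (u : WA R) (h : wmap (Ideal.Quotient.mk (Ideal.span {(n : R)})) u = 0) :
    ∃ u', u = (n : WA R) * u' := by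
  apply exists_mul_of_wmap
  intro v
  rw [← mk_zero_iff, ← wmap_repr, h]; simp

theorem mk_self (n : ℕ) : ((n : ℕ) : R ⧸ Ideal.span {(n : R)}) = 0 := by
  rw [← map_natCast (Ideal.Quotient.mk (Ideal.span {(n : R)})), mk_zero_iff]; exact ⟨1, by simp⟩

theorem pinj {p : ℕ} (hp : p.Prime) : Function.Injective (fun v : ℕ × ℕ => (p * v.1, p * v.2)) := by
  intro v v' h
  simp only [Prod.mk.injEq] at h
  have := hp.pos
  exact Prod.ext (Nat.eq_of_mul_eq_mul_left this h.1) (Nat.eq_of_mul_eq_mul_left this h.2)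

theorem evl_repr {p : ℕ} (hp : p.Prime) (a : ℕ × ℕ →₀ R) (i j : ℕ) :
    (wbas R).repr (evl p a) (p * i, p * j) = a (i, j) := by
  induction a using Finsupp.induction_linear with
  | zero => simp
  | add b b' h1 h2 => simp [h1, h2]
  | single v r =>
    rw [evl, Finsupp.linearCombination_single, map_smul, (wbas R).repr_self, Finsupp.smul_single, smul_eq_mul, mul_one]
    rw [Finsupp.single_apply, Finsupp.single_apply]
    have := (pinj hp).eq_iff (a := v) (b := (i,j))
    simp only at this
    simp only [this]

theorem evl_repr' {p : ℕ} (a : ℕ × ℕ →₀ R) (i j : ℕ) (h : ¬ (p ∣ i ∧ p ∣ j)) :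
    (wbas R).repr (evl p a) (i, j) = 0 := by
  induction a using Finsupp.induction_linear with
  | zero => simp
  | add b b' h1 h2 => simp [h1, h2]
  | single v r =>
    rw [evl, Finsupp.linearCombination_single, map_smul, (wbas R).repr_self, Finsupp.smul_single, smul_eq_mul, mul_one,
      Finsupp.single_apply, if_neg]
    rintro h'
    simp only [Prod.mk.injEq] at h'
    exact h ⟨⟨_, h'.1.symm⟩, ⟨_, h'.2.symm⟩⟩

def pc {p : ℕ} (hp : p.Prime) (u : WA R) : ℕ × ℕ →₀ R :=
  Finsupp.comapDomain (fun v : ℕ × ℕ => (p * v.1, p * v.2)) ((wbas R).repr u) (pinj hp).injOn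

theorem pc_apply {p : ℕ} (hp : p.Prime) (u : WA R) (v) : pc hp u v = (wbas R).repr u (p * v.1, p * v.2) := rfl

theorem div_of_central {p : ℕ} (hp : p.Prime) (C : WA R)
    (hC : ∀ z, Commute (wmap (Ideal.Quotient.mk (Ideal.span {(p : R)})) C) z) :
    (∃ u, C = evl p (pc hp C) + (p : WA R) * u) ∧
    (∀ z, ∃ z', z * evl p (pc hp C) - evl p (pc hp C) * z = (p : WA R) * z') := by
  set f := Ideal.Quotient.mk (Ideal.span {(p : R)})
  have e : wmap f C = wmap f (evl p (pc hp C)) := by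
    apply (wbas _).repr.injective
    ext ⟨i, j⟩
    by_cases h : p ∣ i ∧ p ∣ j
    · obtain ⟨⟨i, rfl⟩, ⟨j, rfl⟩⟩ := h
      rw [wmap_repr, wmap_repr, evl_repr hp, pc_apply]
    · rw [central_supp hp (mk_self p) _ hC i j h, wmap_repr, evl_repr' _ _ _ h, map_zero]
  constructor
  · obtain ⟨u, hu⟩ := wmap_zero p (C - evl p (pc hp C)) (by rw [map_sub, sub_eq_zero]; exact e)
    exact ⟨u, by rw [← hu]; abel⟩
  · intro z
    apply wmap_zero p
    rw [map_sub, map_mul, map_mul]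
    change wmap f z * wmap f _ - wmap f _ * wmap f z = 0
    rw [← e, (hC _).eq, sub_self]

theorem central_A {p : ℕ} (hp : p.Prime) {A B : WA R} (h : B * A = A * B + 1) (z) :
    Commute (wmap (Ideal.Quotient.mk (Ideal.span {(p : R)})) (A ^ p)) z := by
  set f := Ideal.Quotient.mk (Ideal.span {(p : R)})
  have h' : wmap f B * wmap f A = wmap f A * wmap f B + 1 := by
    rw [← map_mul, h, map_add, map_mul, map_one]
  refine pow_p_central hp (mk_self p) h' _ ?_ ?_ z
  · rw [map_pow]; exact (Commute.refl _).pow_left _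
  · rw [map_pow]
    have := rel_pow h' p
    rw [castW (mk_self p), zero_mul, add_zero] at this
    exact this.symm

theorem central_B {p : ℕ} (hp : p.Prime) {A B : WA R} (h : B * A = A * B + 1) (z) :
    Commute (wmap (Ideal.Quotient.mk (Ideal.span {(p : R)})) (B ^ p)) z := by
  set f := Ideal.Quotient.mk (Ideal.span {(p : R)})
  have h' : wmap f B * wmap f A = wmap f A * wmap f B + 1 := by
    rw [← map_mul, h, map_add, map_mul, map_one]
  refine pow_p_central hp (mk_self p) h' _ ?_ ?_ z
  · rw [map_pow]
    have := rel_pow' h' p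
    rw [castW (mk_self p), zero_mul, add_zero] at this
    exact this
  · rw [map_pow]; exact (Commute.refl _).pow_left _

theorem bracket_main [IsDomain R] [CharZero R] {p : ℕ} (hp : p.Prime) {A B : WA R} (h : B * A = A * B + 1) (v : ℕ × ℕ) :
    ∃ c, ((p-1).factorial : R) * (br (pc hp (B ^ p)) (pc hp (A ^ p)) v - Finsupp.single (0,0) 1 v) = p * c := by
  obtain ⟨⟨U, hU⟩, hA⟩ := div_of_central hp (A ^ p) (central_A hp h)
  obtain ⟨⟨V, hV⟩, hB⟩ := div_of_central hp (B ^ p) (central_B hp h)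
  set a := pc hp (A ^ p)
  set b := pc hp (B ^ p)
  set f := Ideal.Quotient.mk (Ideal.span {((p ^ 2 : ℕ) : R)})
  have hp2 : (p : R ⧸ Ideal.span {((p ^ 2 : ℕ) : R)}) ^ 2 = 0 := by
    rw [← Nat.cast_pow]; exact mk_self (p ^ 2)
  have hp2W : (p : WA (R ⧸ Ideal.span {((p ^ 2 : ℕ) : R)})) ^ 2 = 0 := by
    have := congrArg (algebraMap _ (WA (R ⧸ Ideal.span {((p ^ 2 : ℕ) : R)}))) hp2
    simpa using this
  have h' : wmap f B * wmap f A = wmap f A * wmap f B + 1 := by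
    rw [← map_mul, h, map_add, map_mul, map_one]
  have key := pp_of_sq h' p hp hp2W
  rw [← map_pow, ← map_pow, hU, hV] at key
  simp only [map_add, map_mul, map_natCast] at key
  have k2 := ring_aux (p : WA (R ⧸ Ideal.span {((p ^ 2 : ℕ) : R)})) _ _ _ _ _ (fun z => (Nat.cast_commute _ z).eq)
    (by rw [← pow_two, hp2W]) (by
      obtain ⟨z', hz'⟩ := hA V
      have := congrArg (wmap f) hz'
      simp only [map_sub, map_mul, map_natCast] at this
      rw [this, ← mul_assoc, ← pow_two, hp2W, zero_mul]) (by
      obtain ⟨z', hz'⟩ := hB U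
      have := congrArg (wmap f) hz'
      simp only [map_sub, map_mul, map_natCast] at this
      rw [← neg_sub, this, mul_neg, ← mul_assoc, ← pow_two, hp2W, zero_mul, neg_zero]) key
  rw [wmap_evl, wmap_evl, evl_br hp hp2, ← fmap_br, ← wmap_evl, ← sub_eq_zero] at k2
  have k3 : wmap f ((p.factorial : R) • (evl p (br b a - Finsupp.single (0,0) 1))) = 0 := by
    rw [← k2, wmap_smul, map_natCast, Algebra.smul_def, map_natCast, map_sub, map_sub, mul_sub, evl_single]
    simp
  have k4 := congrArg (fun z => (wbas _).repr z (p * v.1, p * v.2)) k3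
  simp only [wmap_repr, map_zero, Finsupp.coe_zero, Pi.zero_apply] at k4
  rw [mk_zero_iff, map_smul, Finsupp.smul_apply, evl_repr hp] at k4
  obtain ⟨c, hc⟩ := k4
  refine ⟨c, ?_⟩
  have hp0 : (p : R) ≠ 0 := by exact_mod_cast hp.ne_zero
  apply mul_left_cancel₀ hp0
  have hf : (p : R) * ((p-1).factorial : R) = (p.factorial : R) := by
    rw [← Nat.cast_mul, Nat.mul_factorial_pred hp.ne_zero]
  rw [← mul_assoc, hf]
  simp only [Finsupp.sub_apply, smul_eq_mul] at hc
  rw [hc]; push_cast; ring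
end br
end WP

namespace WP
open Finset

section comm
variable {k : Type} [Field k]

theorem br_apply (b a : ℕ × ℕ →₀ k) (t : ℕ × ℕ) : br b a t = ∑ v ∈ b.support, ∑ v' ∈ a.support,
    Finsupp.single (v + v' - (1,1)) (b v * a v' * (((v.2 * v'.1 : ℕ) : k) - ((v'.2 * v.1 : ℕ) : k))) t := by
  conv_lhs => rw [← Finsupp.sum_single b, ← Finsupp.sum_single a]
  simp only [Finsupp.sum, map_sum, LinearMap.sum_apply, Finsupp.finsetSum_apply, br_single]
  exact Finset.sum_comm

theorem det_pos {v v' : ℕ × ℕ} (h : v.2 * v'.1 ≠ v'.2 * v.1) : 1 ≤ v.1 + v'.1 ∧ 1 ≤ v.2 + v'.2 := by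
  obtain ⟨i, j⟩ := v
  obtain ⟨i', j'⟩ := v'
  simp only at h ⊢
  constructor
  · by_contra hh
    have h1 : i = 0 := by omega
    have h2 : i' = 0 := by omega
    subst h1 h2; simp at h
  · by_contra hh
    have h1 : j = 0 := by omega
    have h2 : j' = 0 := by omega
    subst h1 h2; simp at h

theorem vertex {p : ℕ} [CharP k p] {D : ℕ} (hD : D * D < p) (a b : ℕ × ℕ →₀ k)
    (ha : ∀ v, a v ≠ 0 → v.1 + v.2 ≤ D) (hb : ∀ v, b v ≠ 0 → v.1 + v.2 ≤ D)
    (hbr : br b a = Finsupp.single (0,0) 1) {va vb : ℕ × ℕ} (hva : a va ≠ 0) (hvb : b vb ≠ 0)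
    (hu : ∀ v v', b v ≠ 0 → a v' ≠ 0 → v + v' = vb + va → v = vb ∧ v' = va)
    (hdet : vb.2 * va.1 ≠ va.2 * vb.1) : vb + va = (1,1) := by
  by_contra hne
  have hpos := det_pos hdet
  have h0 : br b a (vb + va - (1,1)) = 0 := by
    rw [hbr, Finsupp.single_apply, if_neg]
    intro h
    apply hne
    have h1 := congrArg Prod.fst h
    have h2 := congrArg Prod.snd h
    simp only [Prod.fst_sub, Prod.snd_sub, Prod.fst_add, Prod.snd_add] at h1 h2
    ext
    · simp only [Prod.fst_add]; omega
    · simp only [Prod.snd_add]; omega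
  rw [br_apply] at h0
  have key : ∀ v v', b v ≠ 0 → a v' ≠ 0 → (v ≠ vb ∨ v' ≠ va) →
    Finsupp.single (v + v' - (1,1)) (b v * a v' * (((v.2 * v'.1 : ℕ) : k) - ((v'.2 * v.1 : ℕ) : k))) (vb + va - (1,1)) = 0 := by
    intro v v' h1 h2 h3
    by_cases hd : v.2 * v'.1 = v'.2 * v.1
    · rw [hd]; simp
    · rw [Finsupp.single_apply, if_neg]
      intro h
      have hp2 := det_pos hd
      have h4 := congrArg Prod.fst h
      have h5 := congrArg Prod.snd h
      simp only [Prod.fst_sub, Prod.snd_sub, Prod.fst_add, Prod.snd_add] at h4 h5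
      have := hu v v' h1 h2 (by
        ext
        · simp only [Prod.fst_add]; omega
        · simp only [Prod.snd_add]; omega)
      tauto
  rw [Finset.sum_eq_single vb, Finset.sum_eq_single va] at h0
  · rw [Finsupp.single_eq_same] at h0
    have h1 := (mul_eq_zero.1 h0).resolve_left (mul_ne_zero hvb hva)
    rw [sub_eq_zero, CharP.natCast_eq_natCast k p] at h1
    have ha' := ha va hva
    have hb' := hb vb hvb
    apply hdet
    refine Nat.ModEq.eq_of_lt_of_lt h1 ?_ ?_
    · exact lt_of_le_of_lt (Nat.mul_le_mul (by omega) (by omega)) hD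
    · exact lt_of_le_of_lt (Nat.mul_le_mul (by omega) (by omega)) hD
  · intro v' h1 h2
    exact key _ _ hvb (by simpa using h1) (Or.inr h2)
  · intro h; exact absurd hva (by simpa using h)
  · intro v h1 h2
    refine Finset.sum_eq_zero fun v' h3 => ?_
    exact key _ _ (by simpa using h1) (by simpa using h3) (Or.inl h2)
  · intro h; exact absurd hvb (by simpa using h)

theorem vertex2 {p : ℕ} [CharP k p] {D : ℕ} (hD : D * D < p) (a b : ℕ × ℕ →₀ k)
    (ha : ∀ v, a v ≠ 0 → v.1 + v.2 ≤ D) (hb : ∀ v, b v ≠ 0 → v.1 + v.2 ≤ D)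
    (hbr : br b a = Finsupp.single (0,0) 1) (w : ℕ × ℕ → ℚ ×ₗ ℚ) (hw : ∀ v v', w (v + v') = w v + w v')
    (hinj : Function.Injective w) (ha0 : ∃ v, a v ≠ 0) (hb0 : ∃ v, b v ≠ 0) :
    ∃ va vb, a va ≠ 0 ∧ b vb ≠ 0 ∧ (∀ v, a v ≠ 0 → w v ≤ w va) ∧ (∀ v, b v ≠ 0 → w v ≤ w vb) ∧
     (vb.2 * va.1 ≠ va.2 * vb.1 → vb + va = (1,1)) := by
  obtain ⟨va, h1, h2⟩ := a.support.exists_max_image w (by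
    obtain ⟨v, hv⟩ := ha0; exact ⟨v, by simpa using hv⟩)
  obtain ⟨vb, h3, h4⟩ := b.support.exists_max_image w (by
    obtain ⟨v, hv⟩ := hb0; exact ⟨v, by simpa using hv⟩)
  simp only [Finsupp.mem_support_iff] at h1 h2 h3 h4
  refine ⟨va, vb, h1, h3, h2, h4, vertex hD a b ha hb hbr h1 h3 ?_⟩
  intro v v' hv hv' hs
  have e := congrArg w hs
  rw [hw, hw] at e
  have e1 := h4 v hv
  have e2 := h2 v' hv'
  have e3 : w v = w vb := by
    apply le_antisymm e1
    by_contra hlt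
    have := add_lt_add_of_lt_of_le (lt_of_not_ge hlt) e2
    rw [e] at this
    exact lt_irrefl _ this
  rw [e3] at e
  exact ⟨hinj e3, hinj (add_left_cancel e)⟩

theorem comm_lemma {p : ℕ} [CharP k p] {D : ℕ} (hD : D * D < p) (a b : ℕ × ℕ →₀ k)
    (ha : ∀ v, a v ≠ 0 → v.1 + v.2 ≤ D) (hb : ∀ v, b v ≠ 0 → v.1 + v.2 ≤ D)
    (hbo : ∀ v, b v ≠ 0 → Odd v.2)
    (hbr : br b a = Finsupp.single (0,0) 1) : ∀ v, b v ≠ 0 → v = (0,1) := by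
  have wle : ∀ q r s t : ℚ, toLex (q, r) ≤ toLex (s, t) ↔ q < s ∨ q = s ∧ r ≤ t := by
    intro q r s t; rw [Prod.Lex.toLex_le_toLex]
  -- step 0
  have s0 : a (1,0) ≠ 0 ∧ b (0,1) ≠ 0 := by
    have h1 : br b a (0,0) = 1 := by rw [hbr]; simp
    rw [br_apply] at h1
    have h2 : ∃ v ∈ b.support, ∃ v' ∈ a.support, Finsupp.single (v + v' - (1,1)) (b v * a v' * (((v.2 * v'.1 : ℕ) : k) - ((v'.2 * v.1 : ℕ) : k))) (0,0) ≠ 0 := by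
      by_contra hh
      push Not at hh
      rw [Finset.sum_eq_zero fun v hv => Finset.sum_eq_zero fun v' hv' => hh v hv v' hv'] at h1
      exact zero_ne_one h1
    obtain ⟨⟨i, j⟩, hv, ⟨i', j'⟩, hv', h⟩ := h2
    simp only [Finsupp.mem_support_iff] at hv hv'
    have hd : j * i' ≠ j' * i := by
      intro hd
      simp only at h
      rw [hd] at h; simp at h
    have hpos := det_pos (v := (i,j)) (v' := (i',j')) hd
    simp only at hpos
    have ho := hbo _ hv
    rw [Finsupp.single_apply] at h
    split_ifs at h with he
    · have h4 := congrArg Prod.fst he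
      have h5 := congrArg Prod.snd he
      simp only [Prod.fst_sub, Prod.snd_sub, Prod.fst_add, Prod.snd_add] at h4 h5
      simp only at ho
      have hj : j = 1 := by
        rcases ho with ⟨m, hm⟩; omega
      have hj' : j' = 0 := by omega
      subst hj hj'
      have hi' : i' = 1 := by
        simp at hd; omega
      have hi : i = 0 := by omega
      subst hi hi'
      exact ⟨hv', hv⟩
    · exact absurd rfl h
  obtain ⟨sa, sb⟩ := s0
  have hodd : ∀ v, b v ≠ 0 → 1 ≤ v.2 := fun v hv => by
    rcases hbo v hv with ⟨m, hm⟩; omega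
  -- step 1
  have s1 : (∀ i, a (i, 0) ≠ 0 → i ≤ 1) ∧ (∀ i, b (i, 1) ≠ 0 → i = 0) := by
    obtain ⟨⟨i, j⟩, ⟨i', j'⟩, h1, h2, h3, h4, h5⟩ := vertex2 hD a b ha hb hbr
      (fun v => toLex (-(v.2 : ℚ), (v.1 : ℚ))) (by
        intro v v'
        rw [← toLex_add]
        congr 1
        ext <;> simp [add_comm]) (by
        intro v v' h
        have h' := toLex.injective h
        simp only [Prod.mk.injEq, neg_inj, Nat.cast_inj] at h'
        exact Prod.ext h'.2 h'.1) ⟨_, sa⟩ ⟨_, sb⟩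
    have e1 := h3 _ sa
    have e2 := h4 _ sb
    have e3 := hodd _ h2
    simp only [wle] at e1 e2 h3 h4 e3
    simp only [neg_lt_neg_iff, neg_inj, Nat.cast_lt, Nat.cast_inj, Nat.cast_le] at e1 e2 h3 h4
    have hj : j = 0 := by omega
    have hj' : j' = 1 := by omega
    have hi : 1 ≤ i := by omega
    subst hj hj'
    have := h5 (by simp; omega)
    simp only [Prod.mk_add_mk, Prod.mk.injEq] at this
    constructor
    · intro m hm; have := h3 _ hm; simp only at this; omega
    · intro m hm; have := h4 _ hm; simp only at this; omega
  -- step 2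
  by_cases hc : (∀ v, a v ≠ 0 → v.1 ≤ 1) ∧ (∀ v, b v ≠ 0 → v.1 = 0)
  · obtain ⟨⟨i, j⟩, ⟨i', j'⟩, h1, h2, h3, h4, h5⟩ := vertex2 hD a b ha hb hbr
      (fun v => toLex ((v.1 : ℚ), (v.2 : ℚ))) (by
        intro v v'
        rw [← toLex_add]
        congr 1
        ext <;> simp) (by
        intro v v' h
        have h' := toLex.injective h
        simp only [Prod.mk.injEq, Nat.cast_inj] at h'
        exact Prod.ext h'.1 h'.2) ⟨_, sa⟩ ⟨_, sb⟩
    have e1 := h3 _ sa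
    have e3 := hodd _ h2
    have e4 := hc.1 _ h1
    have e5 := hc.2 _ h2
    simp only [wle] at e1 h3 h4 e3 e4 e5
    simp only [Nat.cast_lt, Nat.cast_inj, Nat.cast_le] at e1 h3 h4
    subst e5
    have hi : i = 1 := by omega
    subst hi
    have := h5 (by simp; omega)
    simp only [Prod.mk_add_mk, Prod.mk.injEq] at this
    intro v hv
    have f1 := h4 v hv
    have f2 := hodd v hv
    ext
    · exact hc.2 v hv
    · simp only; omega
  · exfalso
    let Sl : Finset ℚ := ((a.support.filter (fun v => 1 ≤ v.2)).image (fun v => ((v.1 : ℚ) - 1) / v.2)) ∪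
      ((b.support.filter (fun v => 2 ≤ v.2)).image (fun v => (v.1 : ℚ) / ((v.2 : ℚ) - 1)))
    have hpos : ∃ τ ∈ Sl, 0 < τ := by
      rw [not_and_or] at hc
      rcases hc with hc | hc
      · push Not at hc
        obtain ⟨⟨i, j⟩, hv, hi⟩ := hc
        have hj : 1 ≤ j := by
          by_contra hj
          have : j = 0 := by omega
          subst this
          have := s1.1 i hv
          simp only at hi; omega
        refine ⟨((i:ℚ) - 1) / j, ?_, ?_⟩
        · apply Finset.mem_union_left
          exact Finset.mem_image.2 ⟨(i,j), by simp [hv, hj], rfl⟩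
        · have h1 : (1:ℚ) < i := by exact_mod_cast hi
          have h2 : (0:ℚ) < j := by exact_mod_cast hj
          apply div_pos _ h2; linarith
      · push Not at hc
        obtain ⟨⟨i, j⟩, hv, hi⟩ := hc
        have hj : 2 ≤ j := by
          by_contra hj
          have h3 := hodd _ hv
          have : j = 1 := by simp only at h3; omega
          subst this
          exact hi (s1.2 i hv)
        refine ⟨(i:ℚ) / (j - 1), ?_, ?_⟩
        · apply Finset.mem_union_right
          exact Finset.mem_image.2 ⟨(i,j), by simp [hv, hj], rfl⟩
        · have h1 : (0:ℚ) < i := by exact_mod_cast Nat.pos_of_ne_zero hi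
          have h2 : (2:ℚ) ≤ j := by exact_mod_cast hj
          apply div_pos h1; linarith
    obtain ⟨τ0, hτ0, hτ0p⟩ := hpos
    obtain ⟨τ, hτ, hmax⟩ := Sl.exists_max_image id ⟨τ0, hτ0⟩
    simp only [id] at hmax
    have hτp : 0 < τ := lt_of_lt_of_le hτ0p (hmax _ hτ0)
    have ma : ∀ v, a v ≠ 0 → (v.1 : ℚ) - τ * v.2 ≤ 1 := by
      rintro ⟨i, j⟩ hv
      simp only
      by_cases hj : 1 ≤ j
      · have h2 : (0:ℚ) < j := by exact_mod_cast hj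
        have := hmax (((i:ℚ) - 1) / j) (by
          apply Finset.mem_union_left
          exact Finset.mem_image.2 ⟨(i,j), by simp [hv, hj], rfl⟩)
        rw [div_le_iff₀ h2] at this
        linarith
      · have : j = 0 := by omega
        subst this
        have h1 : (i : ℚ) ≤ 1 := by exact_mod_cast s1.1 i hv
        simpa using h1
    have mb : ∀ v, b v ≠ 0 → (v.1 : ℚ) - τ * v.2 ≤ -τ := by
      rintro ⟨i, j⟩ hv
      simp only
      by_cases hj : 2 ≤ j
      · have h2 : (2:ℚ) ≤ j := by exact_mod_cast hj
        have := hmax ((i:ℚ) / (j-1)) (by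
          apply Finset.mem_union_right
          exact Finset.mem_image.2 ⟨(i,j), by simp [hv, hj], rfl⟩)
        rw [div_le_iff₀ (by linarith)] at this
        linarith
      · have h3 := hodd _ hv
        have : j = 1 := by simp only at h3; omega
        subst this
        have := s1.2 i hv
        subst this
        simp
    obtain ⟨⟨i, j⟩, ⟨i', j'⟩, h1, h2, h3, h4, h5⟩ := vertex2 hD a b ha hb hbr
      (fun v => toLex ((v.1 : ℚ) - τ * v.2, (v.2 : ℚ))) (by
        intro v v'
        rw [← toLex_add]
        congr 1
        ext
        · simp; ring
        · simp) (by
        intro v v' h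
        have h' := toLex.injective h
        simp only [Prod.mk.injEq, Nat.cast_inj] at h'
        obtain ⟨h1, h2⟩ := h'
        rw [h2] at h1
        have : (v.1 : ℚ) = v'.1 := by linarith
        exact Prod.ext (by exact_mod_cast this) h2) ⟨_, sa⟩ ⟨_, sb⟩
    simp only [wle, Nat.cast_le] at h3 h4
    have m1 := ma _ h1
    have m2 := mb _ h2
    have o2 := hodd _ h2
    simp only at m1 m2 o2
    have w1 : (i : ℚ) - τ * j = 1 := by
      have := h3 _ sa
      simp only [Nat.cast_one, Nat.cast_zero, mul_zero, sub_zero] at this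
      rcases this with h | h
      · linarith
      · linarith [h.1]
    have w2 : (i' : ℚ) - τ * j' = -τ := by
      have := h4 _ sb
      simp only [Nat.cast_one, Nat.cast_zero, mul_one, zero_sub] at this
      rcases this with h | h
      · linarith
      · linarith [h.1]
    have hdet := h5 (by
      simp only
      intro h
      have hq : (j' : ℚ) * i = j * i' := by exact_mod_cast h
      have e1 : (i : ℚ) = 1 + τ * j := by linarith
      have e2 : (i' : ℚ) = τ * j' - τ := by linarith
      rw [e1, e2] at hq
      have h6 : (1 : ℚ) ≤ j' := by exact_mod_cast o2
      have h7 : (0 : ℚ) ≤ τ * j := by positivity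
      nlinarith)
    simp only [Prod.mk_add_mk, Prod.mk.injEq] at hdet
    have hj : j = 0 := by omega
    have hj' : j' = 1 := by omega
    subst hj hj'
    rcases Finset.mem_union.1 hτ with hm | hm
    · obtain ⟨v, hv, hvτ⟩ := Finset.mem_image.1 hm
      simp only [Finset.mem_filter, Finsupp.mem_support_iff] at hv
      have h6 : (0 : ℚ) < v.2 := by exact_mod_cast hv.2
      rw [div_eq_iff h6.ne'] at hvτ
      have := h3 v hv.1
      rw [w1] at this
      rcases this with h | h
      · linarith
      · omega
    · obtain ⟨v, hv, hvτ⟩ := Finset.mem_image.1 hm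
      simp only [Finset.mem_filter, Finsupp.mem_support_iff] at hv
      have h6 : (2 : ℚ) ≤ v.2 := by exact_mod_cast hv.2
      rw [div_eq_iff (by linarith)] at hvτ
      have := h4 v hv.1
      rw [w2] at this
      rcases this with h | h
      · linarith
      · omega
end comm
end WP

namespace WP

theorem int_jac : IsJacobsonRing ℤ := by
  rw [isJacobsonRing_iff_prime_eq]
  intro P hP
  by_cases h : P = ⊥
  · subst h
    rw [eq_bot_iff]
    intro x hx
    have h1 := Ideal.mem_jacobson_bot.1 hx x
    rcases Int.isUnit_iff.1 h1 with h | h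
    · have : x = 0 := by nlinarith
      simpa using this
    · nlinarith [mul_self_nonneg x]
  · have := hP.isMaximal h
    exact Ideal.jacobson_eq_self_of_isMaximal

theorem choose_field {K : Type} [Field K] [CharZero K] (s : Finset K) :
    ∃ (R : Subalgebra ℤ K) (k : Type) (_ : Field k) (_ : R →+* k) (p : ℕ), (↑s : Set K) ⊆ R ∧ p.Prime ∧ CharP k p := by
  classical
  have := int_jac
  let R := Algebra.adjoin ℤ (↑s : Set K)
  have hR : Algebra.FiniteType ℤ R := (Subalgebra.fg_iff_finiteType _).1 (Subalgebra.fg_adjoin_finset s)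
  obtain ⟨m, hm⟩ := Ideal.exists_maximal R
  let _ := Ideal.Quotient.field m
  have hf : Algebra.FiniteType ℤ (R ⧸ m) := Algebra.FiniteType.of_surjective (Ideal.Quotient.mkₐ ℤ m) (Ideal.Quotient.mkₐ_surjective ℤ m)
  have hfin := finite_of_finite_type_of_isJacobsonRing ℤ (R ⧸ m)
  obtain ⟨p, hp⟩ := CharP.exists (R ⧸ m)
  refine ⟨R, R ⧸ m, inferInstance, Ideal.Quotient.mk m, p, Algebra.subset_adjoin, ?_, hp⟩
  rcases CharP.char_is_prime_or_zero (R ⧸ m) p with h | h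
  · exact h
  · exfalso
    subst h
    have : CharZero (R ⧸ m) := CharP.charP_to_charZero _
    have hI : Algebra.IsIntegral ℤ (R ⧸ m) := inferInstance
    have := isField_of_isIntegral_of_isField (R := ℤ) (S := R ⧸ m) (by exact Int.cast_injective) (Field.toIsField _)
    exact Int.not_isField this
end WP

namespace WP

theorem beta_evl {k : Type} [Field k] {p : ℕ} [CharP k p] (hp : p.Prime) (ho : Odd p) (b : ℕ × ℕ →₀ k) (i j : ℕ) :
    (wbas k).repr (wβ (evl p b)) (p * i, p * j) = (-1) ^ j * b (i, j) := by
  induction b using Finsupp.induction_linear with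
  | zero => simp
  | add f g hf hg => simp [map_add, hf, hg, mul_add]
  | single v r =>
    have h0 : (p : k) = 0 := CharP.cast_eq_zero k p
    have e : wβ (evl p (Finsupp.single v r)) = ((-1 : k) ^ v.2) • evl p (Finsupp.single v r) := by
      rw [evl_single, map_smul, wβ_mul, wβ_pow, wβ_pow, wβ_pow, wβ_pow, wβ_x, wβ_y, ho.neg_pow, smul_comm]
      congr 1
      rw [neg_pow, mul_assoc, ((wxp_comm h0 _).pow_left v.1).symm.eq, Algebra.smul_def]
      simp
    rw [e, map_smul, Finsupp.smul_apply, evl_repr hp, smul_eq_mul]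
    by_cases h : v = (i, j)
    · subst h; rfl
    · simp [Finsupp.single_eq_of_ne' h]

theorem reduction {R : Type} [CommRing R] [IsDomain R] [CharZero R] {k : Type} [Field k] (φ : R →+* k)
    {p : ℕ} [CharP k p] (hp : p.Prime) (h2 : 2 < p) {D : ℕ} (hD : D * D < p) {A B : WA R}
    (h : B * A = A * B + 1) (hβ : wβ B = -B) (hA : ∀ v, (wbas R).repr A v ≠ 0 → v.1 + v.2 ≤ D)
    (hB : ∀ v, (wbas R).repr B v ≠ 0 → v.1 + v.2 ≤ D) (M : ℕ) (v0 : ℕ × ℕ)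
    (hl : ∀ v, (wbas R).repr B v ≠ 0 → v ≠ v0 → v.1 + M * v.2 < v0.1 + M * v0.2)
    (hn : φ ((wbas R).repr B v0) ≠ 0) : v0 = (0, 1) := by
  have ho : Odd p := hp.odd_of_ne_two h2.ne'
  have h0 : (p : k) = 0 := CharP.cast_eq_zero k p
  have deg : ∀ U : WA R, (∀ v, (wbas R).repr U v ≠ 0 → v.1 + v.2 ≤ D) →
      ∀ v, fmap φ (pc hp (U ^ p)) v ≠ 0 → v.1 + v.2 ≤ D := by
    intro U hU v hv
    rw [fmap_apply, pc_apply] at hv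
    have h1 : (wbas R).repr (U ^ p) (p * v.1, p * v.2) ≠ 0 := fun h => hv (by rw [h, map_zero])
    have h3 := mem_FS.1 (FS_deg_pow (mem_FS.2 hU : U ∈ FS R {v | v.1 + v.2 ≤ D}) p) _ h1
    have h4 : p * (v.1 + v.2) ≤ p * D := by
      have : p * v.1 + p * v.2 ≤ p * D := h3
      linarith
    exact Nat.le_of_mul_le_mul_left h4 hp.pos
  refine comm_lemma (p := p) hD (fmap φ (pc hp (A ^ p))) (fmap φ (pc hp (B ^ p))) (deg A hA) (deg B hB) ?_ ?_ v0 ?_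
  · rintro ⟨i, j⟩ hv
    by_contra hc
    rw [Nat.not_odd_iff_even] at hc
    obtain ⟨⟨u, hu⟩, -⟩ := div_of_central hp (B ^ p) (central_B hp h)
    have e1 : wmap φ (B ^ p) = evl p (fmap φ (pc hp (B ^ p))) := by
      conv_lhs => rw [hu]
      rw [map_add, map_mul, wmap_evl, map_natCast, castW h0, zero_mul, add_zero]
    have e2 : wβ (wmap φ (B ^ p)) = - wmap φ (B ^ p) := by
      rw [← wmap_β, wβ_pow, hβ, ho.neg_pow, map_neg]
    rw [e1] at e2
    have e3 := beta_evl hp ho (fmap φ (pc hp (B ^ p))) i j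
    rw [e2, map_neg, Finsupp.neg_apply, evl_repr hp, hc.neg_one_pow, one_mul] at e3
    have h2' : (2 : k) ≠ 0 := by
      intro h
      have : p ∣ 2 := (CharP.cast_eq_zero_iff k p 2).1 (by exact_mod_cast h)
      exact absurd (Nat.le_of_dvd (by norm_num) this) (by omega)
    apply hv
    have : (2 : k) * fmap φ (pc hp (B ^ p)) (i, j) = 0 := by linear_combination -e3
    exact (mul_eq_zero.1 this).resolve_left h2'
  · ext v
    obtain ⟨c, hc⟩ := bracket_main hp h v
    have hc' := congrArg φ hc
    rw [map_mul, map_mul, map_natCast, map_natCast, h0, zero_mul, map_sub, ← fmap_apply, ← fmap_apply, fmap_br, fmap_single, map_one] at hc'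
    have hf : (((p - 1).factorial : ℕ) : k) ≠ 0 := by
      intro h
      rw [CharP.cast_eq_zero_iff k p, hp.dvd_factorial] at h
      have := hp.pos; omega
    exact sub_eq_zero.1 ((mul_eq_zero.1 hc').resolve_left hf)
  · rw [fmap_apply, pc_apply]
    have := lead_coeff M v0 B hl p
    have e : p • v0 = (p * v0.1, p * v0.2) := rfl
    rw [← e, this, map_pow]
    exact pow_ne_zero _ hn

theorem core {K : Type} [Field K] [CharZero K] {A B : WA K} (h : B * A = A * B + 1) (hβ : wβ B = -B) :
    ∃ c : K, c ≠ 0 ∧ B = c • wy K := by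
  classical
  have hB0 : B ≠ 0 := by
    rintro rfl
    have : (1 : WA K) = 0 := by simpa using h.symm
    have h2 := congrArg (fun u => (wbas K).repr u (0,0)) this
    have h3 : (1 : WA K) = wbas K (0,0) := by rw [wbas_apply]; simp
    simp [h3] at h2
  obtain ⟨D, hA, hB⟩ : ∃ D, (∀ v, (wbas K).repr A v ≠ 0 → v.1 + v.2 ≤ D) ∧ (∀ v, (wbas K).repr B v ≠ 0 → v.1 + v.2 ≤ D) := by
    refine ⟨(((wbas K).repr A).support ∪ ((wbas K).repr B).support).sup (fun v => v.1 + v.2), ?_, ?_⟩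
    · intro v hv
      exact Finset.le_sup (f := fun v : ℕ × ℕ => v.1 + v.2) (Finset.mem_union_left _ (Finsupp.mem_support_iff.2 hv))
    · intro v hv
      exact Finset.le_sup (f := fun v : ℕ × ℕ => v.1 + v.2) (Finset.mem_union_right _ (Finsupp.mem_support_iff.2 hv))
  have hne : ((wbas K).repr B).support.Nonempty := by
    rw [Finsupp.support_nonempty_iff]
    simpa using hB0
  obtain ⟨v0, hv0, hmax⟩ := Finset.exists_max_image _ (fun v : ℕ × ℕ => v.1 + (D + 1) * v.2) hne
  have hv0' := Finsupp.mem_support_iff.1 hv0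
  have hl : ∀ v, (wbas K).repr B v ≠ 0 → v ≠ v0 → v.1 + (D+1) * v.2 < v0.1 + (D+1) * v0.2 := by
    intro v hv hne
    refine lt_of_le_of_ne (hmax v (Finsupp.mem_support_iff.2 hv)) ?_
    intro he
    apply hne
    have b1 := hB v hv
    have b2 := hB v0 hv0'
    have m1 : (v.1 + (D+1) * v.2) % (D+1) = v.1 := by
      rw [Nat.add_mul_mod_self_left, Nat.mod_eq_of_lt (by omega)]
    have m2 : (v0.1 + (D+1) * v0.2) % (D+1) = v0.1 := by
      rw [Nat.add_mul_mod_self_left, Nat.mod_eq_of_lt (by omega)]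
    have e1 : v.1 = v0.1 := by rw [← m1, he, m2]
    have e2 : (D+1) * v.2 = (D+1) * v0.2 := by omega
    exact Prod.ext e1 (Nat.eq_of_mul_eq_mul_left (by omega) e2)
  set g := (wbas K).repr B v0 with hg
  set N := D * D + 2 with hN
  obtain ⟨R, k, _, φ, p, hs, hp, hch⟩ := choose_field
    (((wbas K).repr A).support.image ((wbas K).repr A) ∪ ((wbas K).repr B).support.image ((wbas K).repr B)
      ∪ {g⁻¹, ((N.factorial : ℕ) : K)⁻¹})
  have hsub : ∀ x ∈ (((wbas K).repr A).support.image ((wbas K).repr A) ∪ ((wbas K).repr B).support.image ((wbas K).repr B)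
      ∪ {g⁻¹, ((N.factorial : ℕ) : K)⁻¹}), x ∈ R := fun x hx => hs (Finset.mem_coe.2 hx)
  let ι : R →+* K := R.val.toRingHom
  have hι : Function.Injective ι := Subtype.val_injective
  have hr : ∀ x, x ∈ R → x ∈ ι.range := fun x hx => ⟨⟨x, hx⟩, rfl⟩
  obtain ⟨A', hA'⟩ := wmap_range ι A (by
    intro v
    by_cases hv : (wbas K).repr A v = 0
    · rw [hv]; exact zero_mem _
    · exact hr _ (hsub _ (Finset.mem_union_left _ (Finset.mem_union_left _ (Finset.mem_image_of_mem _ (Finsupp.mem_support_iff.2 hv))))))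
  obtain ⟨B', hB'⟩ := wmap_range ι B (by
    intro v
    by_cases hv : (wbas K).repr B v = 0
    · rw [hv]; exact zero_mem _
    · exact hr _ (hsub _ (Finset.mem_union_left _ (Finset.mem_union_right _ (Finset.mem_image_of_mem _ (Finsupp.mem_support_iff.2 hv))))))
  have rA : ∀ v, (wbas K).repr A v = ι ((wbas R).repr A' v) := fun v => by rw [← hA', wmap_repr]
  have rB : ∀ v, (wbas K).repr B v = ι ((wbas R).repr B' v) := fun v => by rw [← hB', wmap_repr]
  have nz : ∀ x : R, x ≠ 0 → ι x ≠ 0 := fun x hx h => hx (hι (by rw [h, map_zero]))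
  have hpN : N < p := by
    by_contra hlt
    push Not at hlt
    have hd : p ∣ N.factorial := hp.dvd_factorial.2 hlt
    let w : R := ⟨((N.factorial : ℕ) : K)⁻¹, hsub _ (by simp)⟩
    have hw : w * ((N.factorial : ℕ) : R) = 1 := by
      apply hι
      rw [map_mul, map_natCast, map_one]
      exact inv_mul_cancel₀ (by exact_mod_cast N.factorial_ne_zero)
    have := congrArg φ hw
    rw [map_mul, map_natCast, (CharP.cast_eq_zero_iff k p _).2 hd, mul_zero, map_one] at this
    exact zero_ne_one this
  have hgk : φ ((wbas R).repr B' v0) ≠ 0 := by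
    let w : R := ⟨g⁻¹, hsub _ (by simp)⟩
    have hw : w * (wbas R).repr B' v0 = 1 := by
      apply hι
      rw [map_mul, map_one, ← rB]
      exact inv_mul_cancel₀ hv0'
    intro h0
    have := congrArg φ hw
    rw [map_mul, h0, mul_zero, map_one] at this
    exact zero_ne_one this
  have hv01 : v0 = (0, 1) := by
    refine reduction φ hp (by omega) (D := D) (by omega) (A := A') (B := B') ?_ ?_ ?_ ?_ (D+1) v0 ?_ hgk
    · apply wmap_inj ι hι
      rw [map_mul, map_add, map_mul, map_one, hA', hB', h]
    · apply wmap_inj ι hι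
      rw [wmap_β, map_neg, hB', hβ]
    · intro v hv; exact hA v (by rw [rA]; exact nz _ hv)
    · intro v hv; exact hB v (by rw [rB]; exact nz _ hv)
    · intro v hv; exact hl v (by rw [rB]; exact nz _ hv)
  subst hv01
  -- B = g Y + q(X)
  refine ⟨g, hv0', ?_⟩
  have hz : ∀ v, v ≠ (0,1) → (wbas K).repr B v ≠ 0 → v.2 = 0 := by
    intro v hne hv
    have := hl v hv hne
    simp only [mul_one, zero_add] at this
    by_contra hc
    have : (D + 1) * 1 ≤ (D+1) * v.2 := Nat.mul_le_mul_left _ (by omega)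
    omega
  have hd : wβ (B - g • wy K) = B - g • wy K := by
    have : B - g • wy K ∈ FS K {v | v.2 = 0} := by
      rw [mem_FS]
      rintro v hv
      have hy : wy K = wbas K (0,1) := by rw [wbas_apply]; simp
      rw [hy, map_sub, map_smul, Module.Basis.repr_self, Finsupp.sub_apply, Finsupp.smul_apply] at hv
      by_cases hvv : v = (0,1)
      · subst hvv; simp [hg] at hv
      · rw [Finsupp.single_eq_of_ne hvv] at hv
        exact hz v hvv (by simpa using hv)
    refine Submodule.span_induction (p := fun u _ => wβ u = u) ?_ (map_zero _) ?_ ?_ this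
    · rintro _ ⟨⟨i, j⟩, hij, rfl⟩
      have hj : j = 0 := hij
      subst hj
      rw [wbas_apply, pow_zero, mul_one, wβ_pow, wβ_x]
    · intro x y _ _ hx hy; rw [map_add, hx, hy]
    · intro c x _ hx; rw [map_smul, hx]
  rw [map_sub, map_smul, hβ, wβ_y, smul_neg] at hd
  have h2 : (2 : K) • (B - g • wy K) = 0 := by
    rw [two_smul]; 
    nth_rewrite 1 [← hd]
    abel
  have := (smul_eq_zero.1 h2).resolve_left (by norm_num)
  exact sub_eq_zero.1 this
end WP

namespace WP
open Polynomial

section fin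
variable {K : Type} [Field K] [CharZero K]

theorem cent_y (u : WA K) (h : wy K * u - u * wy K = 0) : ∃ q : K[X], u = aeval (wy K) q := by
  have : u ∈ FS K {v | v.1 = 0} := by
    rw [mem_FS]
    rintro ⟨i, j⟩ hv
    rcases i with _ | i
    · rfl
    · exfalso
      have := repr_adY u i j
      rw [h, map_zero, Finsupp.zero_apply] at this
      rcases mul_eq_zero.1 this.symm with h1 | h1
      · exact absurd h1 (by exact_mod_cast Nat.succ_ne_zero i)
      · exact hv h1
  refine Submodule.span_induction (p := fun u _ => ∃ q : K[X], u = aeval (wy K) q) ?_ ⟨0, by simp⟩ ?_ ?_ this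
  · rintro _ ⟨⟨i, j⟩, hij, rfl⟩
    have hi : i = 0 := hij
    subst hi
    exact ⟨X ^ j, by rw [wbas_apply]; simp⟩
  · rintro x y _ _ ⟨q, rfl⟩ ⟨r, rfl⟩; exact ⟨q + r, by simp⟩
  · rintro c x _ ⟨q, rfl⟩; exact ⟨c • q, by simp⟩

theorem bij1 (f : WA K →ₐ[K] WA K) (hβ : wβ (f (wy K)) = - f (wy K)) : Function.Bijective f := by
  have h : f (wy K) * f (wx K) = f (wx K) * f (wy K) + 1 := by
    rw [← map_mul, wrel, map_add, map_mul, map_one]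
  obtain ⟨c, hc, hB⟩ := core h hβ
  have hD : wy K * (f (wx K) - c⁻¹ • wx K) - (f (wx K) - c⁻¹ • wx K) * wy K = 0 := by
    have h1 : wy K = c⁻¹ • f (wy K) := by rw [hB, smul_smul, inv_mul_cancel₀ hc, one_smul]
    have e1 : wy K * f (wx K) = f (wx K) * wy K + c⁻¹ • 1 := by
      rw [h1, smul_mul_assoc, h, mul_smul_comm, smul_add]
    rw [mul_sub, sub_mul, e1, mul_smul_comm, smul_mul_assoc, wrel, smul_add]
    abel
  obtain ⟨q, hq⟩ := cent_y _ hD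
  set s := aeval (c⁻¹ • wy K) q with hs
  have hcomm : Commute (wy K) s := by
    have : s ∈ Algebra.adjoin K {c⁻¹ • wy K} := by
      rw [hs]; exact aeval_mem_adjoin_singleton K _
    have h3 : s ∈ Subalgebra.centralizer K {wy K} := by
      refine Algebra.adjoin_le ?_ this
      rintro _ rfl
      rw [SetLike.mem_coe, Subalgebra.mem_centralizer_iff]
      rintro _ rfl
      simp
    exact (Subalgebra.mem_centralizer_iff K).1 h3 _ rfl
  let g : WA K →ₐ[K] WA K := wlift (c • (wx K - s)) (c⁻¹ • wy K) (by
    rw [smul_mul_smul_comm, smul_mul_smul_comm, inv_mul_cancel₀ hc, mul_inv_cancel₀ hc, one_smul, one_smul,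
      mul_sub, sub_mul, wrel, hcomm.eq]
    abel)
  have gx : g (wx K) = c • (wx K - s) := wlift_x _ _ _
  have gy : g (wy K) = c⁻¹ • wy K := wlift_y _ _ _
  have hx : f (wx K) = c⁻¹ • wx K + aeval (wy K) q := by rw [← hq]; abel
  have gf : g.comp f = AlgHom.id K _ := by
    apply walg_ext
    · simp only [AlgHom.comp_apply, AlgHom.id_apply]
      rw [hx, map_add, map_smul, gx, ← aeval_algHom_apply, gy, smul_smul, inv_mul_cancel₀ hc, one_smul, hs]
      abel
    · simp only [AlgHom.comp_apply, AlgHom.id_apply]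
      rw [hB, map_smul, gy, smul_smul, mul_inv_cancel₀ hc, one_smul]
  have fy : f (c⁻¹ • wy K) = wy K := by rw [map_smul, hB, smul_smul, inv_mul_cancel₀ hc, one_smul]
  have fg : f.comp g = AlgHom.id K _ := by
    apply walg_ext
    · simp only [AlgHom.comp_apply, AlgHom.id_apply]
      rw [gx, map_smul, map_sub, hs, ← aeval_algHom_apply, fy, ← hq, sub_sub_cancel, smul_smul, mul_inv_cancel₀ hc, one_smul]
    · simp only [AlgHom.comp_apply, AlgHom.id_apply]
      rw [gy, fy]
  exact Function.bijective_iff_has_inverse.2 ⟨g, fun u => DFunLike.congr_fun gf u, fun u => DFunLike.congr_fun fg u⟩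

theorem bij2 (α : WA K → WA K) (ha : ∀ a b, α (a + b) = α a + α b) (hs : ∀ (c : K) a, α (c • a) = c • α a)
    (hm : ∀ a b, α (a * b) = α b * α a) (h1 : α 1 = 1) (hx : α (wx K) = wy K) (hy : α (wy K) = wx K)
    (F : WA K →ₐ[K] WA K) (hF : ∀ u, F (α u) = α (F u)) : Function.Bijective F := by
  let L : WA K →ₐ[K] WA K := wlift (wx K + wy K) ((2:K)⁻¹ • (wy K - wx K)) (by
    rw [smul_mul_assoc, mul_smul_comm, ← sub_eq_iff_eq_add', ← smul_sub,
      show (wy K - wx K) * (wx K + wy K) - (wx K + wy K) * (wy K - wx K) = 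
        (wy K * wx K - wx K * wy K) + (wy K * wx K - wx K * wy K) by noncomm_ring, wrel, add_sub_cancel_left]
    rw [smul_add, ← add_smul]; norm_num)
  let L' : WA K →ₐ[K] WA K := wlift ((2:K)⁻¹ • wx K - wy K) ((2:K)⁻¹ • wx K + wy K) (by
    simp only [mul_sub, sub_mul, mul_add, add_mul, mul_smul_comm, smul_mul_assoc, wrel, smul_add]
    module)
  have Lx : L (wx K) = wx K + wy K := wlift_x _ _ _
  have Ly : L (wy K) = (2:K)⁻¹ • (wy K - wx K) := wlift_y _ _ _
  have Lx' : L' (wx K) = (2:K)⁻¹ • wx K - wy K := wlift_x _ _ _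
  have Ly' : L' (wy K) = (2:K)⁻¹ • wx K + wy K := wlift_y _ _ _
  have e2 : (2:K) ≠ 0 := two_ne_zero
  have c1 : L.comp L' = AlgHom.id K _ := by
    apply walg_ext
    · simp only [AlgHom.comp_apply, AlgHom.id_apply, Lx', map_sub, map_smul, Lx, Ly]
      module
    · simp only [AlgHom.comp_apply, AlgHom.id_apply, Ly', map_add, map_smul, Lx, Ly]
      module
  have c2 : L'.comp L = AlgHom.id K _ := by
    apply walg_ext
    · simp only [AlgHom.comp_apply, AlgHom.id_apply, Lx', Ly', map_add, map_smul, Lx]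
      module
    · simp only [AlgHom.comp_apply, AlgHom.id_apply, Ly', Lx', map_sub, map_smul, Ly]
      module
  have bL : Function.Bijective L := Function.bijective_iff_has_inverse.2
    ⟨L', fun u => DFunLike.congr_fun c2 u, fun u => DFunLike.congr_fun c1 u⟩
  have bL' : Function.Bijective L' := Function.bijective_iff_has_inverse.2
    ⟨L, fun u => DFunLike.congr_fun c1 u, fun u => DFunLike.congr_fun c2 u⟩
  have key : ∀ u, wβ (L' u) = L' (α u) := by
    intro u
    induction u using winduct with
    | hx => rw [hx, Lx', Ly', map_sub, map_smul, wβ_x, wβ_y, sub_neg_eq_add]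
    | hy => rw [hy, Lx', Ly', map_add, map_smul, wβ_x, wβ_y, sub_eq_add_neg]
    | hr r => 
      rw [AlgHom.commutes, wβ_c, Algebra.algebraMap_eq_smul_one, hs, h1, map_smul, map_one]
    | ha a b h h' => rw [map_add, map_add, h, h', ha, map_add]
    | hm a b h h' => rw [map_mul, wβ_mul, h, h', hm, map_mul]
  have main : Function.Bijective ((L'.comp F).comp L) := by
    apply bij1
    simp only [AlgHom.comp_apply]
    rw [key, ← hF]
    have : α (L (wy K)) = - L (wy K) := by
      rw [Ly, hs, sub_eq_add_neg, ← neg_one_smul K (wx K), ha, hs, hx, hy]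
      module
    rw [this, map_neg, map_neg]
  have m2 : Function.Bijective (L' ∘ F ∘ L) := main
  rw [Function.Bijective.of_comp_iff' bL'] at m2
  exact (Function.Bijective.of_comp_iff F bL).1 m2
end fin
end WP


namespace WP
theorem bij3 {K : Type} [Field K] [CharZero K] (α : Weyl K → Weyl K) (hα : IsExchange K α)
    (F : Weyl K → Weyl K) (hF : IsAlgEndo K F) (hc : F ∘ α = α ∘ F) : Function.Bijective F := by
  obtain ⟨⟨⟨⟨ha, hs, hm, h1⟩, -⟩, -⟩, hx, hy⟩ := hα
  obtain ⟨fa, fs, fm, f1⟩ := hF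
  let F0 : WA K →ₗ[K] WA K := { toFun := F, map_add' := fa, map_smul' := fs }
  let F' : WA K →ₐ[K] WA K := AlgHom.ofLinearMap F0 f1 fm
  exact bij2 (K := K) α ha hs hm h1 hx hy F' (fun u => congrFun hc u)

section
variable {K : Type} [CommSemiring K] {A : Type} [Semiring A] [Algebra K A]

theorem ee {f g : A → A} (hf : IsAlgEndo K f) (hg : IsAlgEndo K g) : IsAlgEndo K (f ∘ g) := by
  obtain ⟨a1, s1, m1, o1⟩ := hf
  obtain ⟨a2, s2, m2, o2⟩ := hg
  exact ⟨fun a b => by simp [a1, a2], fun c a => by simp [s1, s2], fun a b => by simp [m1, m2], by simp [o1, o2]⟩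
theorem ea {f g : A → A} (hf : IsAlgEndo K f) (hg : IsAntiEndo K g) : IsAntiEndo K (f ∘ g) := by
  obtain ⟨a1, s1, m1, o1⟩ := hf
  obtain ⟨a2, s2, m2, o2⟩ := hg
  exact ⟨fun a b => by simp [a1, a2], fun c a => by simp [s1, s2], fun a b => by simp [m1, m2], by simp [o1, o2]⟩
theorem ae {f g : A → A} (hf : IsAntiEndo K f) (hg : IsAlgEndo K g) : IsAntiEndo K (f ∘ g) := by
  obtain ⟨a1, s1, m1, o1⟩ := hf
  obtain ⟨a2, s2, m2, o2⟩ := hg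
  exact ⟨fun a b => by simp [a1, a2], fun c a => by simp [s1, s2], fun a b => by simp [m1, m2], by simp [o1, o2]⟩
theorem aa {f g : A → A} (hf : IsAntiEndo K f) (hg : IsAntiEndo K g) : IsAlgEndo K (f ∘ g) := by
  obtain ⟨a1, s1, m1, o1⟩ := hf
  obtain ⟨a2, s2, m2, o2⟩ := hg
  exact ⟨fun a b => by simp [a1, a2], fun c a => by simp [s1, s2], fun a b => by simp [m1, m2], by simp [o1, o2]⟩

theorem inv_e {g : A → A} (hg : IsAlgAuto K g) : IsAlgEndo K (Function.invFun g) := by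
  obtain ⟨⟨a1, s1, m1, o1⟩, hb⟩ := hg
  have r := Function.rightInverse_invFun hb.2
  refine ⟨fun a b => hb.1 ?_, fun c a => hb.1 ?_, fun a b => hb.1 ?_, hb.1 ?_⟩
  · rw [a1, r, r, r]
  · rw [s1, r, r]
  · rw [m1, r, r, r]
  · rw [r, o1]
theorem inv_a {g : A → A} (hg : IsAntiAuto K g) : IsAntiEndo K (Function.invFun g) := by
  obtain ⟨⟨a1, s1, m1, o1⟩, hb⟩ := hg
  have r := Function.rightInverse_invFun hb.2
  refine ⟨fun a b => hb.1 ?_, fun c a => hb.1 ?_, fun a b => hb.1 ?_, hb.1 ?_⟩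
  · rw [a1, r, r, r]
  · rw [s1, r, r]
  · rw [m1, r, r, r]
  · rw [r, o1]
theorem inv_bij {g : A → A} (hb : Function.Bijective g) : Function.Bijective (Function.invFun g) :=
  Function.bijective_iff_has_inverse.2
    ⟨g, Function.rightInverse_invFun hb.2, Function.leftInverse_invFun hb.1⟩
end
end WP

/-- the Dixmier conjecture is equivalent to the g,h conjecture. -/
theorem stmt_5 {K : Type} [Field K] [CharZero K]
    (α : Weyl K → Weyl K) (hα : IsExchange K α) :
    (∀ f : Weyl K → Weyl K, IsAlgEndo K f → IsAlgAuto K f) ↔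
    (∀ f : Weyl K → Weyl K, IsAlgEndo K f →
      ∃ g h : Weyl K → Weyl K,
        (IsAlgAuto K g ∨ IsAntiAuto K g) ∧ (IsAlgAuto K h ∨ IsAntiAuto K h) ∧
        (h ∘ f ∘ Function.invFun g) ∘ α = α ∘ (h ∘ f ∘ Function.invFun g)) := by
  constructor
  · intro H f hf
    have hb := H f hf
    refine ⟨f, id, Or.inl hb, Or.inl ⟨⟨fun _ _ => rfl, fun _ _ => rfl, fun _ _ => rfl, rfl⟩, Function.bijective_id⟩, ?_⟩
    have e : f ∘ Function.invFun f = id := funext (Function.rightInverse_invFun hb.2.2)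
    rw [e]; rfl
  · intro H f hf
    obtain ⟨g, h, hg, hh, hc⟩ := H f hf
    have hgb : Function.Bijective g := hg.elim And.right And.right
    have hhb : Function.Bijective h := hh.elim And.right And.right
    have hα0 : IsAntiEndo K α := hα.1.1.1
    have key : Function.Bijective (h ∘ f ∘ Function.invFun g) := by
      have anti : IsAntiEndo K (h ∘ f ∘ Function.invFun g) → Function.Bijective (h ∘ f ∘ Function.invFun g) := by
        intro ha
        have := WP.bij3 α hα (α ∘ (h ∘ f ∘ Function.invFun g)) (WP.aa hα0 ha) (by
          rw [Function.comp_assoc, hc])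
        exact (Function.Bijective.of_comp_iff' hα.1.1.2 _).1 this
      rcases hg with hg | hg <;> rcases hh with hh | hh
      · exact WP.bij3 α hα _ (WP.ee hh.1 (WP.ee hf (WP.inv_e hg))) hc
      · exact anti (WP.ae hh.1 (WP.ee hf (WP.inv_e hg)))
      · exact anti (WP.ea hh.1 (WP.ea hf (WP.inv_a hg)))
      · exact WP.bij3 α hα _ (WP.aa hh.1 (WP.ea hf (WP.inv_a hg))) hc
    refine ⟨hf, ?_⟩
    have k2 := (Function.Bijective.of_comp_iff' hhb _).1 key
    exact (Function.Bijective.of_comp_iff f (WP.inv_bij hgb)).1 k2
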